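/- Let $(M,g)$ be a real four-dimensional smooth Lorentzian manifold (signature $+,-,-,-$) with a spin structure: a rank-2 complex vector bundle $\mathbb S$ of (unprimed) spinors with symplectic form $\epsilon_{AB}$ and an identification $TM\otimes\mathbb C\cong\mathbb S\otimes\bar{\mathbb S}$ under which $g_{ab}=\epsilon_{AB}\bar\epsilon_{A'B'}$. Let $\nabla_{AA'}$ be the Levi-Civita connection acting on spinors, and suppose that $g$ solves the vacuum Einstein equations with cosmological constant, $R_{ab}=6\Lambda g_{ab}$ with $\Lambda\in\mathbb R$ constant. Let $\Psi_{ABCD}$ be the Weyl spinor, i.e. the totally symmetric part of $X_{ABCD}$ in the decomposition $R_{abC}{}^{D}=X_{ABC}{}^{D}\bar\epsilon_{A'B'}+\Phi_{A'B'C}{}^{D}\epsilon_{AB}$ of the curvature of $\nabla$ on spinors. Let $U\subseteq M$ be open and let $(o^A,\iota^A)$ be a smooth spin dyad on $U$ with $o_A\iota^A=1$ (indices are lowered by $\xi_B=\xi^A\epsilon_{AB}$). Let $\Psi_0=\Psi_{ABCD}o^Ao^Bo^Co^D$, $\Psi_1=\Psi_{ABCD}o^Ao^Bo^C\iota^D$,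 $\Psi_2=\Psi_{ABCD}o^Ao^B\iota^C\iota^D$, $\Psi_3=\Psi_{ABCD}o^A\iota^B\iota^C\iota^D$, and suppose that the spacetime is of Petrov type II on $U$ with repeated principal spinor $o^A$, i.e. $\Psi_0=\Psi_1=0$ and $\Psi_2\neq0$ on $U$. Let $\Psi_2^{1/3}$ be any continuous branch of the cube root of $\Psi_2$ on $U$. Then the symmetric spinor field $$K_{AB}=\Psi_2^{-1/3}\,o_{(A}\iota_{B)}-\tfrac13\,\Psi_2^{-4/3}\,\Psi_3\,o_Ao_B$$ solves the projected Killing spinor equation $o^A\nabla_{A'(A}K_{BC)}=0$ on $U$, where round brackets denote symmetrization over the enclosed unprimed indices. -/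

import Mathlib

open Bundle VectorField
open scoped Manifold ContDiff Topology

noncomputable section

/-! ### Four-manifolds, Lorentzian metrics, curvature -/

/-- The model space of a real 4-dimensional manifold. -/
abbrev E4 : Type := EuclideanSpace ℝ (Fin 4)

/-- The model fibre of the bundle of unprimed 2-spinors. -/
abbrev SpinorModel : Type := Fin 2 → ℂ

section Manifold

variable {M : Type*} [TopologicalSpace M] [ChartedSpace E4 M] [IsManifold (𝓡 4) ∞ M]

/-- A vector field which is smooth at `x`. -/
def SmoothVectorAt (X : Π x : M, TangentSpace (𝓡 4) x) (x : M) : Prop :=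
  ContMDiffAt (𝓡 4) ((𝓡 4).prod 𝓘(ℝ, E4)) ∞ (fun y ↦ TotalSpace.mk' E4 y (X y)) x

/-- The diagonal entries `(+, -, -, -)` of the Minkowski metric. -/
def minkowskiSign (i : Fin 4) : ℝ := if i = 0 then 1 else -1

/-- Four tangent vectors form an orthonormal basis with respect to a bilinear form
of signature `(+, -, -, -)`. -/
def IsOrthonormalTetrad {V : Type*} (b : V → V → ℝ) (e : Fin 4 → V) : Prop :=
  ∀ i j, b (e i) (e j) = if i = j then minkowskiSign i else 0

variable (M) in
/-- A smooth Lorentzian metric of signature `(+, -, -, -)`. -/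
structure LorentzMetric where
  inner (x : M) : TangentSpace (𝓡 4) x →L[ℝ] TangentSpace (𝓡 4) x →L[ℝ] ℝ
  symm (x : M) (v w : TangentSpace (𝓡 4) x) : inner x v w = inner x w v
  signature (x : M) : ∃ e : Fin 4 → TangentSpace (𝓡 4) x,
    IsOrthonormalTetrad (fun v w ↦ inner x v w) e
  contMDiff : ContMDiff (𝓡 4) ((𝓡 4).prod 𝓘(ℝ, E4 →L[ℝ] E4 →L[ℝ] ℝ)) ∞
    (fun x ↦ TotalSpace.mk' (E4 →L[ℝ] E4 →L[ℝ] ℝ) x (inner x))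

/-- The curvature `R(X,Y)σ = ∇_X ∇_Y σ - ∇_Y ∇_X σ - ∇_[X,Y] σ` of a covariant derivative
(recall that `cov σ x v` is `∇_v σ` at `x`). -/
def CovariantDerivative.curvature {F : Type*} [NormedAddCommGroup F] [NormedSpace ℝ F]
    {V : M → Type*} [TopologicalSpace (TotalSpace F V)]
    [∀ x, AddCommGroup (V x)] [∀ x, Module ℝ (V x)] [∀ x, TopologicalSpace (V x)]
    [∀ x, IsTopologicalAddGroup (V x)] [∀ x, ContinuousSMul ℝ (V x)] [FiberBundle F V]
    (cov : CovariantDerivative (𝓡 4) F V) (X Y : Π x : M, TangentSpace (𝓡 4) x)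
    (σ : Π x : M, V x) : Π x : M, V x := fun x ↦
  cov (fun y ↦ cov σ y (Y y)) x (X x) - cov (fun y ↦ cov σ y (X y)) x (Y x)
    - cov σ x (mlieBracket (𝓡 4) X Y x)

/-- `D` is the Levi-Civita connection of `g`: it is smooth, torsion-free and metric. -/
structure LorentzMetric.IsLeviCivita (g : LorentzMetric M)
    (D : CovariantDerivative (𝓡 4) E4 (TangentSpace (𝓡 4) : M → Type _)) : Prop where
  smooth (u : Set M) (hu : IsOpen u) : ContMDiffCovariantDerivativeOn E4 ∞ D.toFun u
  torsion_free : D.torsion = 0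
  metric (x : M) (Y Z : Π x : M, TangentSpace (𝓡 4) x)
    (hY : SmoothVectorAt Y x) (hZ : SmoothVectorAt Z x) (v : TangentSpace (𝓡 4) x) :
    mvfderiv (𝓡 4) (fun y ↦ g.inner y (Y y) (Z y)) x v
      = g.inner x (D Y x v) (Z x) + g.inner x (Y x) (D Z x v)

/-- The Ricci tensor `R_{ab} = R_{acb}{}^c`, i.e. the trace of `Z ↦ R(X,Z)Y`, evaluated at `x`
with the help of fields `e` that are orthonormal at `x`. -/
def LorentzMetric.ricci (g : LorentzMetric M)
    (D : CovariantDerivative (𝓡 4) E4 (TangentSpace (𝓡 4) : M → Type _))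
    (e : Fin 4 → Π x : M, TangentSpace (𝓡 4) x) (X Y : Π x : M, TangentSpace (𝓡 4) x)
    (x : M) : ℝ :=
  ∑ i, minkowskiSign i * g.inner x (D.curvature X (e i) Y x) (e i x)

/-- The vacuum Einstein equations with cosmological constant `6Λ`: `R_{ab} = 6 Λ g_{ab}`. -/
def LorentzMetric.IsEinstein (g : LorentzMetric M)
    (D : CovariantDerivative (𝓡 4) E4 (TangentSpace (𝓡 4) : M → Type _)) (Λ : ℝ) : Prop :=
  ∀ (x : M) (e : Fin 4 → Π x : M, TangentSpace (𝓡 4) x)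
    (X Y : Π x : M, TangentSpace (𝓡 4) x),
    (∀ i, SmoothVectorAt (e i) x) → SmoothVectorAt X x → SmoothVectorAt Y x →
    IsOrthonormalTetrad (fun v w ↦ g.inner x v w) (fun i ↦ e i x) →
    g.ricci D e X Y x = 6 * Λ * g.inner x (X x) (Y x)

end Manifold

/-! ### Two-spinors -/

section Spinors

variable {M : Type*} [TopologicalSpace M] [ChartedSpace E4 M] [IsManifold (𝓡 4) ∞ M]
  {S : M → Type*} [TopologicalSpace (TotalSpace SpinorModel S)]
  [∀ x, AddCommGroup (S x)] [∀ x, Module ℂ (S x)] [∀ x, TopologicalSpace (S x)]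
  [∀ x, IsTopologicalAddGroup (S x)] [∀ x, ContinuousSMul ℝ (S x)]
  [FiberBundle SpinorModel S] [VectorBundle ℝ SpinorModel S] [VectorBundle ℂ SpinorModel S]
  [ContMDiffVectorBundle ∞ SpinorModel S (𝓡 4)]

/-- A spinor field which is smooth at `x`. -/
def SmoothSpinorAt (σ : Π x : M, S x) (x : M) : Prop :=
  ContMDiffAt (𝓡 4) ((𝓡 4).prod 𝓘(ℝ, SpinorModel)) ∞
    (fun y ↦ TotalSpace.mk' SpinorModel y (σ y)) x

variable (S) in
/-- The structure making the rank-2 complex vector bundle `S` the bundle of (unprimed) 2-spinors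
of `(M,g)`: a symplectic form `ε_{AB}` and an identification of `TM ⊗ ℂ` with `S ⊗ S̄`
under which `g_{ab} = ε_{AB} ε̄_{A'B'}`.

The identification is given by the real vectors `solder α β = Re (α^A β̄^{A'})`; the complex
vector `α^A β̄^{A'}` itself is then `solder α β + i • solder α (i β)`. The conditions
`solder_I` and `solder_symm` say that this is a sesquilinear expression with
`conj (α^A β̄^{A'}) = β^A ᾱ^{A'}`; the condition `metric` is, by polarization,
`g_{ab} = ε_{AB} ε̄_{A'B'}`, and it forces the map from Hermitian elements of
`S ⊗ S̄` to tangent vectors to be an isomorphism. -/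
structure SpinStructure (g : LorentzMetric M) where
  eps (x : M) : S x →ₗ[ℂ] S x →ₗ[ℂ] ℂ
  eps_self (x : M) (α : S x) : eps x α α = 0
  eps_nondegenerate (x : M) (α : S x) : (∀ β, eps x α β = 0) → α = 0
  solder (x : M) : S x →ₗ[ℝ] S x →ₗ[ℝ] TangentSpace (𝓡 4) x
  solder_symm (x : M) (α β : S x) : solder x α β = solder x β α
  solder_I (x : M) (α β : S x) : solder x (Complex.I • α) (Complex.I • β) = solder x α β
  metric (x : M) (α β : S x) :
    g.inner x (solder x α α) (solder x β β) = ‖eps x α β‖ ^ 2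
  eps_smooth (x : M) (α β : Π x : M, S x) :
    SmoothSpinorAt α x → SmoothSpinorAt β x →
    ContMDiffAt (𝓡 4) 𝓘(ℝ, ℂ) ∞ (fun y ↦ eps y (α y) (β y)) x
  solder_smooth (x : M) (α β : Π x : M, S x) :
    SmoothSpinorAt α x → SmoothSpinorAt β x →
    SmoothVectorAt (fun y ↦ solder y (α y) (β y)) x

namespace SpinStructure

variable {g : LorentzMetric M} (sp : SpinStructure S g)

/-- `nabla` is the spinor covariant derivative determined by the Levi-Civita connection `D`:
it is smooth and complex linear, and `ε` and the identification of `TM ⊗ ℂ` with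
`S ⊗ S̄` are parallel. -/
structure IsSpinConnection
    (D : CovariantDerivative (𝓡 4) E4 (TangentSpace (𝓡 4) : M → Type _))
    (nabla : CovariantDerivative (𝓡 4) SpinorModel S) : Prop where
  smooth (u : Set M) (hu : IsOpen u) :
    ContMDiffCovariantDerivativeOn SpinorModel ∞ nabla.toFun u
  smul_I (x : M) (α : Π x : M, S x) (hα : SmoothSpinorAt α x) (v : TangentSpace (𝓡 4) x) :
    nabla (fun y ↦ Complex.I • α y) x v = Complex.I • nabla α x v
  eps_parallel (x : M) (α β : Π x : M, S x)
    (hα : SmoothSpinorAt α x) (hβ : SmoothSpinorAt β x) (v : TangentSpace (𝓡 4) x) :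
    mvfderiv (𝓡 4) (fun y ↦ sp.eps y (α y) (β y)) x v
      = sp.eps x (nabla α x v) (β x) + sp.eps x (α x) (nabla β x v)
  solder_parallel (x : M) (α β : Π x : M, S x)
    (hα : SmoothSpinorAt α x) (hβ : SmoothSpinorAt β x) (v : TangentSpace (𝓡 4) x) :
    D (fun y ↦ sp.solder y (α y) (β y)) x v
      = sp.solder x (nabla α x v) (β x) + sp.solder x (α x) (nabla β x v)

/-- `(o, ι)` is a smooth spin dyad on `U`, normalized by `o_A ι^A = 1`. Indices are lowered by
`ξ_B = ξ^A ε_{AB}`, so that `ξ_A η^A = ε(ξ, η)`. -/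
structure IsDyadOn (U : Set M) (o ι : Π x : M, S x) : Prop where
  smooth_fst : ∀ x ∈ U, SmoothSpinorAt o x
  smooth_snd : ∀ x ∈ U, SmoothSpinorAt ι x
  normalized : ∀ x ∈ U, sp.eps x (o x) (ι x) = 1

/-- The real part of the complex vector field `α^A μ̄^{A'}`. -/
def reVec (α μ : Π x : M, S x) : Π x : M, TangentSpace (𝓡 4) x :=
  fun x ↦ sp.solder x (α x) (μ x)

/-- The imaginary part of the complex vector field `α^A μ̄^{A'}`. -/
def imVec (α μ : Π x : M, S x) : Π x : M, TangentSpace (𝓡 4) x :=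
  fun x ↦ sp.solder x (α x) (Complex.I • μ x)

variable (nabla : CovariantDerivative (𝓡 4) SpinorModel S)

/-- The spinor curvature `R(α^A μ̄^{A'}, β^B ν̄^{B'}) γ`, the curvature of the spin connection
extended complex bilinearly to complex vector fields. -/
def spinorCurvature (α μ β ν γ : Π x : M, S x) : Π x : M, S x := fun x ↦
  (nabla.curvature (sp.reVec α μ) (sp.reVec β ν) γ x
      - nabla.curvature (sp.imVec α μ) (sp.imVec β ν) γ x)
    + Complex.I • (nabla.curvature (sp.reVec α μ) (sp.imVec β ν) γ x
      + nabla.curvature (sp.imVec α μ) (sp.reVec β ν) γ x)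

/-- The curvature spinor `X_{ABCD} α^A β^B γ^C δ^D`. It is defined by
`R_{abC}{}^D = X_{ABC}{}^D ε̄_{A'B'} + Φ_{A'B'C}{}^D ε_{AB}` with `Φ_{A'B'C}{}^D` symmetric
in `A'B'`, hence `X_{ABC}{}^D = (1/2) (ō^{A'} ῑ^{B'} - ῑ^{A'} ō^{B'}) R_{abC}{}^D` for every
normalized dyad `(o, ι)`. -/
def curvatureSpinor (o ι α β γ δ : Π x : M, S x) (x : M) : ℂ :=
  (1 / 2) * sp.eps x
    (sp.spinorCurvature nabla α o β ι γ x - sp.spinorCurvature nabla α ι β o γ x) (δ x)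

/-- The Weyl spinor `Ψ_{ABCD} α^A β^B γ^C δ^D`, where
`Ψ_{ABCD} = X_{(ABCD)} = X_{A(BCD)} = (1/3) (X_{ABCD} + X_{ACBD} + X_{ADBC})`; recall that
`X_{ABCD} = X_{(AB)(CD)} = X_{CDAB}`. -/
def weylSpinor (o ι α β γ δ : Π x : M, S x) (x : M) : ℂ :=
  (1 / 3) * (sp.curvatureSpinor nabla o ι α β γ δ x + sp.curvatureSpinor nabla o ι α γ β δ x
    + sp.curvatureSpinor nabla o ι α δ β γ x)

/-- The Weyl scalar `Ψ₀ = Ψ_{ABCD} o^A o^B o^C o^D`. -/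
def Psi0 (o ι : Π x : M, S x) : M → ℂ := sp.weylSpinor nabla o ι o o o o

/-- The Weyl scalar `Ψ₁ = Ψ_{ABCD} o^A o^B o^C ι^D`. -/
def Psi1 (o ι : Π x : M, S x) : M → ℂ := sp.weylSpinor nabla o ι o o o ι

/-- The Weyl scalar `Ψ₂ = Ψ_{ABCD} o^A o^B ι^C ι^D`. -/
def Psi2 (o ι : Π x : M, S x) : M → ℂ := sp.weylSpinor nabla o ι o o ι ι

/-- The Weyl scalar `Ψ₃ = Ψ_{ABCD} o^A ι^B ι^C ι^D`. -/
def Psi3 (o ι : Π x : M, S x) : M → ℂ := sp.weylSpinor nabla o ι o ι ι ι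

/-- The spacetime is of Petrov type II on `U` with repeated principal spinor `o`. -/
structure IsTypeIIOn (U : Set M) (o ι : Π x : M, S x) : Prop where
  Psi0_eq : ∀ x ∈ U, sp.Psi0 nabla o ι x = 0
  Psi1_eq : ∀ x ∈ U, sp.Psi1 nabla o ι x = 0
  Psi2_ne : ∀ x ∈ U, sp.Psi2 nabla o ι x ≠ 0

/-- The covariant derivative `v^a ∇_a K_{BC} β^B γ^C` of a valence-2 spinor field along a real
tangent vector `v`. -/
def covDeriv₂ (K : Π x : M, S x →ₗ[ℂ] S x →ₗ[ℂ] ℂ) (β γ : Π x : M, S x) (x : M)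
    (v : TangentSpace (𝓡 4) x) : ℂ :=
  mvfderiv (𝓡 4) (fun y ↦ K y (β y) (γ y)) x v
    - K x (nabla β x v) (γ x) - K x (β x) (nabla γ x v)

/-- `α^A μ̄^{A'} β^B γ^C ∇_{AA'} K_{BC}`. -/
def spinorDeriv₂ (K : Π x : M, S x →ₗ[ℂ] S x →ₗ[ℂ] ℂ) (μ α β γ : Π x : M, S x)
    (x : M) : ℂ :=
  covDeriv₂ nabla K β γ x (sp.reVec α μ x) + Complex.I * covDeriv₂ nabla K β γ x (sp.imVec α μ x)

/-- `α^A β^B γ^C μ̄^{A'} ∇_{A'(A} K_{BC)}`. -/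
def symDeriv₂ (K : Π x : M, S x →ₗ[ℂ] S x →ₗ[ℂ] ℂ) (μ α β γ : Π x : M, S x)
    (x : M) : ℂ :=
  (1 / 6) * (sp.spinorDeriv₂ nabla K μ α β γ x + sp.spinorDeriv₂ nabla K μ α γ β x
    + sp.spinorDeriv₂ nabla K μ β α γ x + sp.spinorDeriv₂ nabla K μ β γ α x
    + sp.spinorDeriv₂ nabla K μ γ α β x + sp.spinorDeriv₂ nabla K μ γ β α x)

/-- The projected Killing spinor equation `o^A ∇_{A'(A} K_{BC)} = 0` on `U`. -/
def IsProjectedKillingSpinorOn (U : Set M) (o : Π x : M, S x)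
    (K : Π x : M, S x →ₗ[ℂ] S x →ₗ[ℂ] ℂ) : Prop :=
  ∀ x ∈ U, ∀ β γ μ : Π x : M, S x,
    SmoothSpinorAt β x → SmoothSpinorAt γ x → SmoothSpinorAt μ x →
    sp.symDeriv₂ nabla K μ o β γ x = 0

/-- The 1-form `ξ_A`, i.e. `η^A ↦ ξ_A η^A`. -/
def lower (ξ : Π x : M, S x) (x : M) : S x →ₗ[ℂ] ℂ := sp.eps x (ξ x)

/-- The tensor product `ξ_A η_B`. -/
def lowerMul (ξ η : Π x : M, S x) (x : M) : S x →ₗ[ℂ] S x →ₗ[ℂ] ℂ :=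
  (sp.lower ξ x).smulRight (sp.lower η x)

/-- `K_{AB} = Ψ₂^{-1/3} o_{(A} ι_{B)} - (1/3) Ψ₂^{-4/3} Ψ₃ o_A o_B`, where `φ` is the chosen
branch of `Ψ₂^{1/3}`. -/
def killingField (o ι : Π x : M, S x) (φ : M → ℂ) (x : M) : S x →ₗ[ℂ] S x →ₗ[ℂ] ℂ :=
  (φ x)⁻¹ • ((1 / 2 : ℂ) • (sp.lowerMul o ι x + sp.lowerMul ι o x))
    - ((1 / 3 : ℂ) * (φ x ^ 4)⁻¹ * sp.Psi3 nabla o ι x) • sp.lowerMul o o x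

end SpinStructure

end Spinors

end

set_option linter.unusedSectionVars false
set_option linter.unusedSimpArgs false

noncomputable section

section Calculus

variable {M : Type*} [TopologicalSpace M] [ChartedSpace E4 M]

theorem mvfderiv_congr {F : Type*} [NormedAddCommGroup F] [NormedSpace ℝ F] {f g : M → F} {x : M}
    (h : ∀ᶠ y in 𝓝 x, f y = g y) : mvfderiv (𝓡 4) f x = mvfderiv (𝓡 4) g x := by
  have h' : f =ᶠ[𝓝 x] g := h
  ext v
  simp only [mvfderiv, ContinuousLinearMap.comp_apply, h'.mfderiv_eq]
  rfl

theorem mvfderiv_complex_mul {f g : M → ℂ} {x : M} (hf : MDifferentiableAt (𝓡 4) 𝓘(ℝ, ℂ) f x)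
    (hg : MDifferentiableAt (𝓡 4) 𝓘(ℝ, ℂ) g x) (v : TangentSpace (𝓡 4) x) :
    mvfderiv (𝓡 4) (fun y ↦ f y * g y) x v
      = mvfderiv (𝓡 4) f x v * g x + f x * mvfderiv (𝓡 4) g x v := by
  have h := (hf.hasMFDerivAt.mul' hg.hasMFDerivAt).mfderiv
  have h2 : mvfderiv (𝓡 4) (f * g) x v = _ := congrArg (fun L ↦ L v) h
  rw [show (fun y ↦ f y * g y) = f * g from rfl, h2]
  exact add_comm _ _

theorem mvfderiv_clm_comp {F G : Type*} [NormedAddCommGroup F] [NormedSpace ℝ F]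
    [NormedAddCommGroup G] [NormedSpace ℝ G] (L : F →L[ℝ] G) {f : M → F} {x : M}
    (hf : MDifferentiableAt (𝓡 4) 𝓘(ℝ, F) f x) (v : TangentSpace (𝓡 4) x) :
    mvfderiv (𝓡 4) (fun y ↦ L (f y)) x v = L (mvfderiv (𝓡 4) f x v) := by
  have h := mfderiv_comp x (L.mdifferentiableAt (x := f x)) hf
  have h2 : mvfderiv (𝓡 4) (L ∘ f) x v = _ := congrArg (fun L ↦ L v) h
  rw [show (fun y ↦ L (f y)) = L ∘ f from rfl, h2]
  rw [ContinuousLinearMap.mfderiv_eq]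
  rfl

variable [IsManifold (𝓡 4) ∞ M]

theorem jacobi_mlieBracket {X Y Z : Π x : M, TangentSpace (𝓡 4) x} {x : M}
    (hX : SmoothVectorAt X x) (hY : SmoothVectorAt Y x) (hZ : SmoothVectorAt Z x) :
    mlieBracket (𝓡 4) X (mlieBracket (𝓡 4) Y Z) x =
      mlieBracket (𝓡 4) (mlieBracket (𝓡 4) X Y) Z x
        + mlieBracket (𝓡 4) Y (mlieBracket (𝓡 4) X Z) x := by
  have : IsManifold (𝓡 4) (minSmoothness ℝ 3) M := by
    rw [minSmoothness_of_isRCLikeNormedField]; exact IsManifold.of_le (n := ∞) (WithTop.coe_le_coe.2 (le_top : (3 : ℕ∞) ≤ ⊤))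
  have h2 : minSmoothness ℝ 2 ≤ ∞ := by
    rw [minSmoothness_of_isRCLikeNormedField]; exact WithTop.coe_le_coe.2 (le_top : (2 : ℕ∞) ≤ ⊤)
  exact leibniz_identity_mlieBracket_apply (ContMDiffAt.of_le hX h2) (ContMDiffAt.of_le hY h2)
    (ContMDiffAt.of_le hZ h2)

theorem SmoothVectorAt.mlieBracket {X Y : Π x : M, TangentSpace (𝓡 4) x} {x : M}
    (hX : SmoothVectorAt X x) (hY : SmoothVectorAt Y x) :
    SmoothVectorAt (mlieBracket (𝓡 4) X Y) x := by
  have : IsManifold (𝓡 4) (((⊤ : ℕ∞) : WithTop ℕ∞) + 1) M := by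
    exact (inferInstance : IsManifold (𝓡 4) ∞ M)
  have : IsManifold (𝓡 4) (minSmoothness ℝ 2) M := by
    rw [minSmoothness_of_isRCLikeNormedField]; infer_instance
  refine ContMDiffAt.mlieBracket_vectorField (m := ⊤) (n := ⊤) hX hY ?_
  rw [minSmoothness_of_isRCLikeNormedField]; exact le_rfl

theorem SmoothVectorAt.mdiff {X : Π x : M, TangentSpace (𝓡 4) x} {x : M}
    (hX : SmoothVectorAt X x) :
    MDifferentiableAt (𝓡 4) ((𝓡 4).prod 𝓘(ℝ, E4)) (fun y ↦ TotalSpace.mk' E4 y (X y)) x :=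
  ContMDiffAt.mdifferentiableAt hX (by simp)

/-- The commutator of two derivations is the derivation along the Lie bracket. -/
theorem mvfderiv_commutator {U : Set M} (hU : IsOpen U) {f : M → ℝ}
    {X Y Z : Π x : M, TangentSpace (𝓡 4) x}
    (hf : ∀ y ∈ U, ContMDiffAt (𝓡 4) 𝓘(ℝ, ℝ) ∞ f y) (hX : ∀ y ∈ U, SmoothVectorAt X y)
    (hY : ∀ y ∈ U, SmoothVectorAt Y y) (hZ : ∀ y ∈ U, SmoothVectorAt Z y)
    {x : M} (hx : x ∈ U) (hZx : Z x ≠ 0)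
    (hfX : MDifferentiableAt (𝓡 4) 𝓘(ℝ, ℝ) (fun y ↦ mvfderiv (𝓡 4) f y (X y)) x)
    (hfY : MDifferentiableAt (𝓡 4) 𝓘(ℝ, ℝ) (fun y ↦ mvfderiv (𝓡 4) f y (Y y)) x) :
    mvfderiv (𝓡 4) (fun y ↦ mvfderiv (𝓡 4) f y (Y y)) x (X x)
      - mvfderiv (𝓡 4) (fun y ↦ mvfderiv (𝓡 4) f y (X y)) x (Y x)
      = mvfderiv (𝓡 4) f x (mlieBracket (𝓡 4) X Y x) := by
  have hfd : ∀ y ∈ U, MDifferentiableAt (𝓡 4) 𝓘(ℝ, ℝ) f y :=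
    fun y hy ↦ (hf y hy).mdifferentiableAt (by simp)
  have key : ∀ (A B : Π x : M, TangentSpace (𝓡 4) x), (∀ y ∈ U, SmoothVectorAt B y) →
      MDifferentiableAt (𝓡 4) 𝓘(ℝ, ℝ) (fun y ↦ mvfderiv (𝓡 4) f y (B y)) x →
      mlieBracket (𝓡 4) A (mlieBracket (𝓡 4) B (f • Z)) x =
        (mvfderiv (𝓡 4) (fun y ↦ mvfderiv (𝓡 4) f y (B y)) x (A x) • Z x
          + mvfderiv (𝓡 4) f x (B x) • mlieBracket (𝓡 4) A Z x)
        + (mvfderiv (𝓡 4) f x (A x) • mlieBracket (𝓡 4) B Z x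
          + f x • mlieBracket (𝓡 4) A (mlieBracket (𝓡 4) B Z) x) := by
    intro A B hB hfB
    have e : mlieBracket (𝓡 4) B (f • Z) =ᶠ[𝓝 x]
        (fun y ↦ mvfderiv (𝓡 4) f y (B y)) • Z + f • mlieBracket (𝓡 4) B Z := by
      filter_upwards [hU.mem_nhds hx] with y hy
      rw [mlieBracket_smul_right (hfd y hy) (hZ y hy).mdiff]
      rfl
    have hBZ := ((hB x hx).mlieBracket (hZ x hx)).mdiff
    rw [Filter.EventuallyEq.mlieBracket_vectorField_eq (Filter.EventuallyEq.refl _ A) e,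
      mlieBracket_add_right, mlieBracket_smul_right hfB (hZ x hx).mdiff,
      mlieBracket_smul_right (hfd x hx) hBZ]
    · exact MDifferentiableAt.smul_section hfB (hZ x hx).mdiff
    · exact MDifferentiableAt.smul_section (hfd x hx) hBZ
  have hfZ : SmoothVectorAt (f • Z) x := ContMDiffAt.smul_section (hf x hx) (hZ x hx)
  have h1 := jacobi_mlieBracket (hX x hx) (hY x hx) hfZ
  have h2 := jacobi_mlieBracket (hX x hx) (hY x hx) (hZ x hx)
  rw [key X Y hY hfY, key Y X hX hfX, mlieBracket_smul_right (hfd x hx) (hZ x hx).mdiff, h2] at h1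
  rw [← sub_eq_zero]
  refine (smul_eq_zero.mp (?_ : _ • Z x = 0)).resolve_right hZx
  rw [← sub_eq_zero] at h1
  rw [← h1]
  module

end Calculus

section Curvature

variable {M : Type*} [TopologicalSpace M] [ChartedSpace E4 M]
  {F : Type*} [NormedAddCommGroup F] [NormedSpace ℝ F]
  {V : M → Type*} [TopologicalSpace (TotalSpace F V)]
  [∀ x, AddCommGroup (V x)] [∀ x, Module ℝ (V x)] [∀ x, TopologicalSpace (V x)]
  [∀ x, IsTopologicalAddGroup (V x)] [∀ x, ContinuousSMul ℝ (V x)] [FiberBundle F V]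

variable (F) in
/-- A section of a vector bundle which is smooth at every point of `U`. -/
def SmoothSectionOn (U : Set M) (σ : Π x : M, V x) : Prop :=
  ∀ x ∈ U, ContMDiffAt (𝓡 4) ((𝓡 4).prod 𝓘(ℝ, F)) ∞ (fun y ↦ TotalSpace.mk' F y (σ y)) x

theorem SmoothSectionOn.mdiff {U : Set M} {σ : Π x : M, V x} (h : SmoothSectionOn F U σ) {x : M}
    (hx : x ∈ U) : MDifferentiableAt (𝓡 4) ((𝓡 4).prod 𝓘(ℝ, F))
      (fun y ↦ TotalSpace.mk' F y (σ y)) x :=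
  (h x hx).mdifferentiableAt (by simp)

namespace CovariantDerivative

variable (cov : CovariantDerivative (𝓡 4) F V)

theorem congr_section {U : Set M} (hU : IsOpen U) {σ τ : Π x : M, V x}
    (hσ : SmoothSectionOn F U σ) (hτ : SmoothSectionOn F U τ) (h : ∀ y ∈ U, σ y = τ y)
    {x : M} (hx : x ∈ U) : cov σ x = cov τ x :=
  cov.isCovariantDerivativeOn.congr_of_eqOn (hσ.mdiff hx) (hτ.mdiff hx) (hU.mem_nhds hx) h

theorem map_add {σ τ : Π x : M, V x} {U : Set M} (hσ : SmoothSectionOn F U σ)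
    (hτ : SmoothSectionOn F U τ) {x : M} (hx : x ∈ U) (v : TangentSpace (𝓡 4) x) :
    cov (fun y ↦ σ y + τ y) x v = cov σ x v + cov τ x v := by
  have h := cov.isCovariantDerivativeOnUniv.add (hσ.mdiff hx) (hτ.mdiff hx)
  rw [show (fun y ↦ σ y + τ y) = σ + τ from rfl, h]
  rfl

variable [VectorBundle ℝ F V]

theorem map_sub {σ τ : Π x : M, V x} {U : Set M} (hσ : SmoothSectionOn F U σ)
    (hτ : SmoothSectionOn F U τ) {x : M} (hx : x ∈ U) (v : TangentSpace (𝓡 4) x) :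
    cov (fun y ↦ σ y - τ y) x v = cov σ x v - cov τ x v := by
  have hs : SmoothSectionOn F U ((-1 : ℝ) • τ) :=
    fun y hy ↦ ContMDiffAt.const_smul_section (hτ y hy)
  have h := cov.isCovariantDerivativeOnUniv.add (hσ.mdiff hx) (hs.mdiff hx)
  rw [cov.isCovariantDerivativeOnUniv.smul_const _ (hτ.mdiff hx)] at h
  have e : (fun y ↦ σ y - τ y) = σ + (-1 : ℝ) • τ := by
    funext y
    simp [sub_eq_add_neg]
  rw [e, h]
  simp [sub_eq_add_neg]

theorem map_sub₃ {σ τ υ : Π x : M, V x} {U : Set M} (hσ : SmoothSectionOn F U σ)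
    (hτ : SmoothSectionOn F U τ) (hυ : SmoothSectionOn F U υ) {x : M} (hx : x ∈ U)
    (v : TangentSpace (𝓡 4) x) :
    cov (fun y ↦ σ y - τ y - υ y) x v = cov σ x v - cov τ x v - cov υ x v := by
  rw [cov.map_sub (σ := fun y ↦ σ y - τ y) (fun y hy ↦ ContMDiffAt.sub_section (hσ y hy) (hτ y hy))
    hυ hx, cov.map_sub hσ hτ hx]

variable [IsManifold (𝓡 4) ∞ M]

section Smooth

variable {cov} {U : Set M} {σ : Π x : M, V x} {X Y Z : Π x : M, TangentSpace (𝓡 4) x}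

theorem contMDiffOn_hom (hcov : ContMDiffCovariantDerivativeOn F ∞ cov.toFun U)
    (hU : IsOpen U) (hσ : SmoothSectionOn F U σ) {x : M} (hx : x ∈ U) :
    ContMDiffAt (𝓡 4) ((𝓡 4).prod 𝓘(ℝ, E4 →L[ℝ] F)) ∞
      (fun y ↦ TotalSpace.mk' (E4 →L[ℝ] F)
        (E := fun y ↦ TangentSpace (𝓡 4) y →L[ℝ] V y) y (cov σ y)) x := by
  have h : ContMDiffOn (𝓡 4) ((𝓡 4).prod 𝓘(ℝ, F)) (∞ + 1) (fun y ↦ TotalSpace.mk' F y (σ y)) U :=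
    fun y hy ↦ (hσ y hy).contMDiffWithinAt
  exact (hcov.contMDiff h).contMDiffAt (hU.mem_nhds hx)

theorem smooth_apply (hcov : ContMDiffCovariantDerivativeOn F ∞ cov.toFun U)
    (hU : IsOpen U) (hσ : SmoothSectionOn F U σ) (hX : SmoothSectionOn E4 U X) :
    SmoothSectionOn F U (fun y ↦ cov σ y (X y)) := fun x hx ↦
  ContMDiffAt.clm_bundle_apply (contMDiffOn_hom hcov hU hσ hx) (hX x hx)

theorem smooth_mlieBracket (hX : SmoothSectionOn E4 U X) (hY : SmoothSectionOn E4 U Y) :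
    SmoothSectionOn E4 U (mlieBracket (𝓡 4) X Y) := fun x hx ↦
  SmoothVectorAt.mlieBracket (hX x hx) (hY x hx)

theorem smooth_curvature (hcov : ContMDiffCovariantDerivativeOn F ∞ cov.toFun U)
    (hU : IsOpen U) (hσ : SmoothSectionOn F U σ) (hX : SmoothSectionOn E4 U X)
    (hY : SmoothSectionOn E4 U Y) : SmoothSectionOn F U (cov.curvature X Y σ) := fun x hx ↦
  ContMDiffAt.sub_section (ContMDiffAt.sub_section
    (smooth_apply hcov hU (smooth_apply hcov hU hσ hY) hX x hx)
    (smooth_apply hcov hU (smooth_apply hcov hU hσ hX) hY x hx))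
    (smooth_apply hcov hU hσ (smooth_mlieBracket hX hY) x hx)

theorem curvature_swap (X Y : Π x : M, TangentSpace (𝓡 4) x) (σ : Π x : M, V x) (x : M) :
    cov.curvature Y X σ x = - cov.curvature X Y σ x := by
  simp only [curvature]
  rw [mlieBracket_swap_apply, _root_.map_neg]
  abel

/-- The curvature is tensorial in its first vector argument. -/
theorem curvature_tensorialAt (hcov : ContMDiffCovariantDerivativeOn F ∞ cov.toFun U)
    (hU : IsOpen U) (hσ : SmoothSectionOn F U σ) {x : M} (hx : x ∈ U) :
    TensorialAt (𝓡 4) E4 (fun X : Π x : M, TangentSpace (𝓡 4) x ↦ cov.curvature X Y σ x) x := by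
  have hd : ∀ {X : Π x : M, TangentSpace (𝓡 4) x},
      MDifferentiableAt (𝓡 4) ((𝓡 4).prod 𝓘(ℝ, E4)) (fun y ↦ TotalSpace.mk' E4 y (X y)) x →
      MDifferentiableAt (𝓡 4) ((𝓡 4).prod 𝓘(ℝ, F))
        (fun y ↦ TotalSpace.mk' F y (cov σ y (X y))) x := fun hX ↦
    MDifferentiableAt.clm_bundle_apply
      ((contMDiffOn_hom hcov hU hσ hx).mdifferentiableAt (by simp)) hX
  constructor
  · intro f X hf hX
    have e : (fun y ↦ cov σ y ((f • X) y)) = f • fun y ↦ cov σ y (X y) := by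
      funext y; simp
    simp only [curvature]
    rw [e, cov.isCovariantDerivativeOnUniv.leibniz (hd hX) hf, mlieBracket_smul_left hf hX]
    simp
    module
  · intro X X' hX hX'
    have e : (fun y ↦ cov σ y ((X + X') y))
        = (fun y ↦ cov σ y (X y)) + fun y ↦ cov σ y (X' y) := by
      funext y; simp
    simp only [curvature]
    rw [e, cov.isCovariantDerivativeOnUniv.add (hd hX) (hd hX'), mlieBracket_add_left hX hX']
    simp
    abel

/-- The second Bianchi identity. -/
theorem second_bianchi (hcov : ContMDiffCovariantDerivativeOn F ∞ cov.toFun U)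
    (hU : IsOpen U) (hσ : SmoothSectionOn F U σ) (hX : SmoothSectionOn E4 U X)
    (hY : SmoothSectionOn E4 U Y) (hZ : SmoothSectionOn E4 U Z) {x : M} (hx : x ∈ U) :
    (cov (cov.curvature Y Z σ) x (X x) - cov.curvature Y Z (fun y ↦ cov σ y (X y)) x
        - cov.curvature (mlieBracket (𝓡 4) X Y) Z σ x)
      + (cov (cov.curvature Z X σ) x (Y x) - cov.curvature Z X (fun y ↦ cov σ y (Y y)) x
        - cov.curvature (mlieBracket (𝓡 4) Y Z) X σ x)
      + (cov (cov.curvature X Y σ) x (Z x) - cov.curvature X Y (fun y ↦ cov σ y (Z y)) x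
        - cov.curvature (mlieBracket (𝓡 4) Z X) Y σ x) = 0 := by
  have key : ∀ {A B : Π x : M, TangentSpace (𝓡 4) x}, SmoothSectionOn E4 U A →
      SmoothSectionOn E4 U B → ∀ v, cov (cov.curvature A B σ) x v
        = cov (fun y ↦ cov (fun z ↦ cov σ z (B z)) y (A y)) x v
          - cov (fun y ↦ cov (fun z ↦ cov σ z (A z)) y (B y)) x v
          - cov (fun y ↦ cov σ y (mlieBracket (𝓡 4) A B y)) x v := fun hA hB v ↦
    cov.map_sub₃ (smooth_apply hcov hU (smooth_apply hcov hU hσ hB) hA)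
      (smooth_apply hcov hU (smooth_apply hcov hU hσ hA) hB)
      (smooth_apply hcov hU hσ (smooth_mlieBracket hA hB)) hx v
  rw [key hX hY, key hY hZ, key hZ hX]
  have J : mlieBracket (𝓡 4) (mlieBracket (𝓡 4) X Y) Z x
      + mlieBracket (𝓡 4) (mlieBracket (𝓡 4) Y Z) X x
      + mlieBracket (𝓡 4) (mlieBracket (𝓡 4) Z X) Y x = 0 := by
    have h := jacobi_mlieBracket (hX x hx) (hY x hx) (hZ x hx)
    rw [mlieBracket_swap_apply (V := X) (W := mlieBracket (𝓡 4) Y Z),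
      mlieBracket_swap_apply (V := Y) (W := mlieBracket (𝓡 4) X Z),
      mlieBracket_swap (V := X) (W := Z)] at h
    have e : mlieBracket (𝓡 4) (-mlieBracket (𝓡 4) Z X) Y x
        = - mlieBracket (𝓡 4) (mlieBracket (𝓡 4) Z X) Y x := by
      have := mlieBracket_const_smul_left (I := 𝓡 4) (c := (-1 : ℝ)) (W := Y)
        ((smooth_mlieBracket hZ hX).mdiff hx)
      simpa using this
    rw [e] at h
    rw [← neg_eq_zero, ← sub_eq_zero.2 h]
    abel
  have J' := congrArg (cov σ x) J
  simp only [_root_.map_add, _root_.map_zero] at J'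
  simp only [curvature]
  rw [← J']
  abel

end Smooth

/-- The first Bianchi identity for a torsion-free connection. -/
theorem first_bianchi {D : CovariantDerivative (𝓡 4) E4 (TangentSpace (𝓡 4) : M → Type _)}
    {U : Set M} (hD : ContMDiffCovariantDerivativeOn E4 ∞ D.toFun U) (htor : D.torsion = 0)
    (hU : IsOpen U) {X Y Z : Π x : M, TangentSpace (𝓡 4) x} (hX : SmoothSectionOn E4 U X)
    (hY : SmoothSectionOn E4 U Y) (hZ : SmoothSectionOn E4 U Z) {x : M} (hx : x ∈ U) :
    D.curvature X Y Z x + D.curvature Y Z X x + D.curvature Z X Y x = 0 := by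
  have T : ∀ {A B : Π x : M, TangentSpace (𝓡 4) x}, SmoothSectionOn E4 U A →
      SmoothSectionOn E4 U B → ∀ y ∈ U, mlieBracket (𝓡 4) A B y = D B y (A y) - D A y (B y) :=
    fun hA hB y hy ↦ (D.torsion_eq_zero_iff.1 htor (hA.mdiff hy) (hB.mdiff hy)).symm
  have key : ∀ {A B C : Π x : M, TangentSpace (𝓡 4) x}, SmoothSectionOn E4 U A →
      SmoothSectionOn E4 U B → SmoothSectionOn E4 U C →
      mlieBracket (𝓡 4) A (mlieBracket (𝓡 4) B C) x
        = D (fun y ↦ D C y (B y)) x (A x) - D (fun y ↦ D B y (C y)) x (A x)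
          - D A x (mlieBracket (𝓡 4) B C x) := by
    intro A B C hA hB hC
    rw [T hA (smooth_mlieBracket hB hC) x hx, D.congr_section hU (smooth_mlieBracket hB hC)
      (fun y hy ↦ ContMDiffAt.sub_section (smooth_apply hD hU hC hB y hy)
        (smooth_apply hD hU hB hC y hy)) (T hB hC) hx]
    exact congrArg (· - _) (D.map_sub (smooth_apply hD hU hC hB) (smooth_apply hD hU hB hC) hx _)
  have J := jacobi_mlieBracket (hX x hx) (hY x hx) (hZ x hx)
  rw [mlieBracket_swap_apply (W := Z), key hX hY hZ, key hY hX hZ, key hZ hX hY] at J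
  rw [← sub_eq_zero.2 J]
  simp only [curvature]
  rw [mlieBracket_swap_apply (V := Z) (W := X), _root_.map_neg]
  abel

end CovariantDerivative

end Curvature

section Calculus

variable {M : Type*} [TopologicalSpace M] [ChartedSpace E4 M] [IsManifold (𝓡 4) ∞ M]

theorem mvfderiv_commutator_complex {U : Set M} (hU : IsOpen U) {f : M → ℂ}
    {X Y Z : Π x : M, TangentSpace (𝓡 4) x}
    (hf : ∀ y ∈ U, ContMDiffAt (𝓡 4) 𝓘(ℝ, ℂ) ∞ f y) (hX : SmoothSectionOn E4 U X)
    (hY : SmoothSectionOn E4 U Y) (hZ : SmoothSectionOn E4 U Z)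
    {x : M} (hx : x ∈ U) (hZx : Z x ≠ 0)
    (hfX : MDifferentiableAt (𝓡 4) 𝓘(ℝ, ℂ) (fun y ↦ mvfderiv (𝓡 4) f y (X y)) x)
    (hfY : MDifferentiableAt (𝓡 4) 𝓘(ℝ, ℂ) (fun y ↦ mvfderiv (𝓡 4) f y (Y y)) x) :
    mvfderiv (𝓡 4) (fun y ↦ mvfderiv (𝓡 4) f y (Y y)) x (X x)
      - mvfderiv (𝓡 4) (fun y ↦ mvfderiv (𝓡 4) f y (X y)) x (Y x)
      = mvfderiv (𝓡 4) f x (mlieBracket (𝓡 4) X Y x) := by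
  have hfd : ∀ y ∈ U, MDifferentiableAt (𝓡 4) 𝓘(ℝ, ℂ) f y :=
    fun y hy ↦ (hf y hy).mdifferentiableAt (by simp)
  have key : ∀ L : ℂ →L[ℝ] ℝ,
      L (mvfderiv (𝓡 4) (fun y ↦ mvfderiv (𝓡 4) f y (Y y)) x (X x)
        - mvfderiv (𝓡 4) (fun y ↦ mvfderiv (𝓡 4) f y (X y)) x (Y x))
      = L (mvfderiv (𝓡 4) f x (mlieBracket (𝓡 4) X Y x)) := by
    intro L
    have hL : ∀ {g : M → ℂ} {y : M}, MDifferentiableAt (𝓡 4) 𝓘(ℝ, ℂ) g y →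
        MDifferentiableAt (𝓡 4) 𝓘(ℝ, ℝ) (fun z ↦ L (g z)) y :=
      fun hg ↦ L.mdifferentiableAt.comp _ hg
    have e : ∀ A : Π x : M, TangentSpace (𝓡 4) x,
        ∀ᶠ y in 𝓝 x, mvfderiv (𝓡 4) (fun z ↦ L (f z)) y (A y) = L (mvfderiv (𝓡 4) f y (A y)) :=
      fun A ↦ by
        filter_upwards [hU.mem_nhds hx] with y hy
        exact mvfderiv_clm_comp L (hfd y hy) _
    have h := mvfderiv_commutator hU (f := fun z ↦ L (f z))
      (fun y hy ↦ L.contMDiff.contMDiffAt.comp y (hf y hy)) hX hY hZ hx hZx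
      ((hL hfX).congr_of_eventuallyEq (e X)) ((hL hfY).congr_of_eventuallyEq (e Y))
    rw [mvfderiv_congr (e X), mvfderiv_congr (e Y), mvfderiv_clm_comp L hfX,
      mvfderiv_clm_comp L hfY, mvfderiv_clm_comp L (hfd x hx)] at h
    rw [_root_.map_sub, h]
  exact Complex.ext (key Complex.reCLM) (key Complex.imCLM)

end Calculus

section Spinors

variable {M : Type*} [TopologicalSpace M] [ChartedSpace E4 M] [IsManifold (𝓡 4) ∞ M]
  {S : M → Type*} [TopologicalSpace (TotalSpace SpinorModel S)]
  [∀ x, AddCommGroup (S x)] [∀ x, Module ℂ (S x)] [∀ x, TopologicalSpace (S x)]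
  [∀ x, IsTopologicalAddGroup (S x)] [∀ x, ContinuousSMul ℝ (S x)]
  [FiberBundle SpinorModel S] [VectorBundle ℝ SpinorModel S] [VectorBundle ℂ SpinorModel S]
  [ContMDiffVectorBundle ∞ SpinorModel S (𝓡 4)]

theorem SmoothSpinorAt.smul_I {σ : Π x : M, S x} {x : M} (h : SmoothSpinorAt σ x) :
    SmoothSpinorAt (fun y ↦ Complex.I • σ y) x := by
  unfold SmoothSpinorAt at h ⊢
  rw [Bundle.contMDiffAt_section] at h ⊢
  let L : SpinorModel →L[ℝ] SpinorModel :=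
    (Complex.I • ContinuousLinearMap.id ℂ SpinorModel).restrictScalars ℝ
  refine (L.contMDiff.contMDiffAt.comp x h).congr_of_eventuallyEq ?_
  filter_upwards [(trivializationAt SpinorModel S x).open_baseSet.mem_nhds
    (FiberBundle.mem_baseSet_trivializationAt' x)] with y hy
  exact ((trivializationAt SpinorModel S x).linear ℂ hy).map_smul Complex.I (σ y)

namespace SpinStructure

variable {g : LorentzMetric M} (sp : SpinStructure S g)

theorem eps_swap (x : M) (α β : S x) : sp.eps x β α = - sp.eps x α β := by
  have h := sp.eps_self x (α + β)
  simp only [_root_.map_add, LinearMap.add_apply, sp.eps_self] at h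
  linear_combination h

theorem dyad_expand {x : M} {o ι : S x} (h : sp.eps x o ι = 1) (ψ : S x) :
    ψ = sp.eps x ψ ι • o + sp.eps x o ψ • ι := by
  have e : S x ≃ₗ[ℂ] SpinorModel := (trivializationAt SpinorModel S x).linearEquivAt ℂ x
    (FiberBundle.mem_baseSet_trivializationAt' x)
  have hfin : Module.finrank ℂ (S x) = 2 := by rw [e.finrank_eq]; simp
  have : Module.Finite ℂ (S x) := Module.Finite.equiv e.symm
  have hli : LinearIndependent ℂ ![o, ι] := by
    rw [LinearIndependent.pair_iff]
    intro s t hst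
    have h1 := congrArg (fun z ↦ sp.eps x z ι) hst
    have h2 := congrArg (fun z ↦ sp.eps x o z) hst
    simp [sp.eps_self, h] at h1 h2
    exact ⟨h1, h2⟩
  have hsp := hli.span_eq_top_of_card_eq_finrank (by simp [hfin])
  have hm : ψ ∈ Submodule.span ℂ (Set.range ![o, ι]) := hsp ▸ Submodule.mem_top
  simp only [Matrix.range_cons, Matrix.range_empty, Set.union_empty, Set.singleton_union] at hm
  obtain ⟨a, b, rfl⟩ := Submodule.mem_span_pair.1 hm
  simp [sp.eps_self, h]

theorem eps_dyad {x : M} {o ι : S x} (h : sp.eps x o ι = 1) (ψ χ : S x) :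
    sp.eps x ψ χ = sp.eps x ψ ι * sp.eps x o χ - sp.eps x ψ o * sp.eps x ι χ := by
  conv_lhs => rw [sp.dyad_expand h ψ]
  simp only [_root_.map_add, LinearMap.add_apply, map_smul, LinearMap.smul_apply, smul_eq_mul]
  rw [sp.eps_swap x ψ o]
  ring

/-- `(o, ι)` is a normalized spin dyad on the open set `U`, `D` is the Levi-Civita connection and
`nabla` is the spin connection it determines. -/
structure IsSpinFrame (D : CovariantDerivative (𝓡 4) E4 (TangentSpace (𝓡 4) : M → Type _))
    (nabla : CovariantDerivative (𝓡 4) SpinorModel S) (U : Set M) (o ι : Π x : M, S x) :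
    Prop where
  leviCivita : g.IsLeviCivita D
  spin : sp.IsSpinConnection D nabla
  isOpen : IsOpen U
  dyad : sp.IsDyadOn U o ι

/-- The real tetrad `o^A ō^{A'}`, `ι^A ῑ^{A'}`, `Re (o^A ῑ^{A'})`, `Im (o^A ῑ^{A'})`. -/
def tetrad (o ι : Π x : M, S x) : Fin 4 → Π x : M, TangentSpace (𝓡 4) x :=
  ![sp.reVec o o, sp.reVec ι ι, sp.reVec o ι, sp.imVec o ι]

/-- The Gram matrix of `tetrad`. -/
def tetradGram : Matrix (Fin 4) (Fin 4) ℝ :=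
  !![0, 1, 0, 0; 1, 0, 0, 0; 0, 0, -1 / 2, 0; 0, 0, 0, -1 / 2]

theorem solder_I_left (x : M) (α β : S x) :
    sp.solder x (Complex.I • α) β = - sp.solder x α (Complex.I • β) := by
  have h := sp.solder_I x α (Complex.I • β)
  rw [smul_smul, Complex.I_mul_I, neg_one_smul, _root_.map_neg] at h
  rw [← h, neg_neg]

theorem solder_self_I (x : M) (α : S x) : sp.solder x α (Complex.I • α) = 0 := by
  have h := sp.solder_I_left x α α
  rw [sp.solder_symm, eq_neg_iff_add_eq_zero, ← two_smul ℝ] at h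
  exact (smul_eq_zero.1 h).resolve_left two_ne_zero

theorem complex_smul_eq {x : M} (z : ℂ) (α : S x) :
    z • α = z.re • α + z.im • (Complex.I • α) := by
  conv_lhs => rw [← Complex.re_add_im z, add_smul, mul_smul]
  rfl

theorem solder_smul_left (x : M) (z : ℂ) (α β : S x) :
    sp.solder x (z • α) β
      = z.re • sp.solder x α β - z.im • sp.solder x α (Complex.I • β) := by
  rw [complex_smul_eq]
  simp only [_root_.map_add, LinearMap.add_apply, map_smul, LinearMap.smul_apply,
    sp.solder_I_left]
  module

theorem solder_smul_right (x : M) (z : ℂ) (α β : S x) :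
    sp.solder x α (z • β)
      = z.re • sp.solder x α β + z.im • sp.solder x α (Complex.I • β) := by
  rw [complex_smul_eq]
  simp only [_root_.map_add, map_smul]

theorem inner_tetrad {o ι : Π x : M, S x} {x : M} (h : sp.eps x (o x) (ι x) = 1) (i j : Fin 4) :
    g.inner x (sp.tetrad o ι i x) (sp.tetrad o ι j x) = tetradGram i j := by
  have hs : sp.eps x (ι x) (o x) = -1 := by rw [sp.eps_swap, h]
  have V1 : sp.solder x (o x + ι x) (o x + ι x)
      = sp.solder x (o x) (o x) + sp.solder x (ι x) (ι x)
        + (2 : ℝ) • sp.solder x (o x) (ι x) := by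
    simp only [_root_.map_add, LinearMap.add_apply]
    rw [sp.solder_symm x (ι x) (o x)]
    module
  have V2 : sp.solder x (o x + Complex.I • ι x) (o x + Complex.I • ι x)
      = sp.solder x (o x) (o x) + sp.solder x (ι x) (ι x)
        + (2 : ℝ) • sp.solder x (o x) (Complex.I • ι x) := by
    simp only [_root_.map_add, LinearMap.add_apply]
    rw [sp.solder_symm x (Complex.I • ι x) (o x), sp.solder_I]
    module
  have h11 := sp.metric x (o x) (o x)
  have h12 := sp.metric x (o x) (ι x)
  have h22 := sp.metric x (ι x) (ι x)
  have h13 := sp.metric x (o x) (o x + ι x)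
  have h23 := sp.metric x (ι x) (o x + ι x)
  have h33 := sp.metric x (o x + ι x) (o x + ι x)
  have h14 := sp.metric x (o x) (o x + Complex.I • ι x)
  have h24 := sp.metric x (ι x) (o x + Complex.I • ι x)
  have h44 := sp.metric x (o x + Complex.I • ι x) (o x + Complex.I • ι x)
  have h34 := sp.metric x (o x + ι x) (o x + Complex.I • ι x)
  have h21 := g.symm x (sp.solder x (ι x) (ι x)) (sp.solder x (o x) (o x))
  have h31 := g.symm x (sp.solder x (o x) (ι x)) (sp.solder x (o x) (o x))
  have h41 := g.symm x (sp.solder x (o x) (Complex.I • ι x)) (sp.solder x (o x) (o x))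
  have h32 := g.symm x (sp.solder x (o x) (ι x)) (sp.solder x (ι x) (ι x))
  have h42 := g.symm x (sp.solder x (o x) (Complex.I • ι x)) (sp.solder x (ι x) (ι x))
  have h43 := g.symm x (sp.solder x (o x) (Complex.I • ι x)) (sp.solder x (o x) (ι x))
  have hn : ‖Complex.I - 1‖ ^ 2 = 2 := by
    rw [← Complex.normSq_eq_norm_sq]; simp [Complex.normSq_apply]; norm_num
  rw [V1] at h13 h23 h33 h34
  rw [V2] at h14 h24 h44 h34
  simp only [_root_.map_add, LinearMap.add_apply, map_smul, smul_eq_mul, sp.eps_self, h, hs,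
    _root_.add_apply, _root_.smul_apply, LinearMap.smul_apply]
    at h11 h12 h22 h13 h23 h33 h14 h24 h44 h34
  rw [show (0 + (-1 : ℂ) + Complex.I * (1 + 0)) = Complex.I - 1 by ring, hn] at h34
  norm_num at h11 h12 h22 h13 h23 h33 h14 h24 h44
  fin_cases i <;> fin_cases j <;>
    simp only [tetrad, reVec, imVec, tetradGram, Fin.mk_zero, Fin.mk_one, Fin.reduceFinMk,
      Matrix.cons_val, Matrix.of_apply, Fin.isValue, Matrix.cons_val_zero, Matrix.cons_val_one] <;>
    linarith

end SpinStructure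

end Spinors

section Spinors

variable {M : Type*} [TopologicalSpace M] [ChartedSpace E4 M] [IsManifold (𝓡 4) ∞ M]
  {S : M → Type*} [TopologicalSpace (TotalSpace SpinorModel S)]
  [∀ x, AddCommGroup (S x)] [∀ x, Module ℂ (S x)] [∀ x, TopologicalSpace (S x)]
  [∀ x, IsTopologicalAddGroup (S x)] [∀ x, ContinuousSMul ℝ (S x)]
  [FiberBundle SpinorModel S] [VectorBundle ℝ SpinorModel S] [VectorBundle ℂ SpinorModel S]
  [ContMDiffVectorBundle ∞ SpinorModel S (𝓡 4)]

namespace SpinStructure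

variable {g : LorentzMetric M} {sp : SpinStructure S g}

/-- The variation of the tetrad under the infinitesimal change
`o ↦ w₀₁ o - w₀₀ ι`, `ι ↦ w₁₁ o - w₀₁ ι` of the dyad. -/
def tetradVariation {V : Type*} [AddCommGroup V] [Module ℝ V] (w₀₀ w₀₁ w₁₁ : ℂ)
    (E : Fin 4 → V) : Fin 4 → V :=
  ![(2 * w₀₁.re) • E 0 - (2 * w₀₀.re) • E 2 - (2 * w₀₀.im) • E 3,
    -((2 * w₀₁.re) • E 1) + (2 * w₁₁.re) • E 2 - (2 * w₁₁.im) • E 3,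
    -(w₀₀.re • E 1) + w₁₁.re • E 0 - (2 * w₀₁.im) • E 3,
    (2 * w₀₁.im) • E 2 - w₀₀.im • E 1 - w₁₁.im • E 0]

theorem tetradVariation_eq (o ι : Π x : M, S x) (x : M) {o' ι' : S x} {w₀₀ w₀₁ w₁₁ : ℂ}
    (ho : o' = w₀₁ • o x - w₀₀ • ι x) (hι : ι' = w₁₁ • o x - w₀₁ • ι x) :
    tetradVariation w₀₀ w₀₁ w₁₁ (fun j ↦ sp.tetrad o ι j x)
      = ![sp.solder x o' (o x) + sp.solder x (o x) o', sp.solder x ι' (ι x) + sp.solder x (ι x) ι',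
        sp.solder x o' (ι x) + sp.solder x (o x) ι',
        sp.solder x o' (Complex.I • ι x) + sp.solder x (o x) (Complex.I • ι')] := by
  have e1 : sp.solder x (ι x) (Complex.I • o x) = - sp.solder x (o x) (Complex.I • ι x) := by
    rw [sp.solder_symm, sp.solder_I_left]
  have e2 : ∀ (z : ℂ) (α β : S x), sp.solder x α (Complex.I • z • β)
      = z.re • sp.solder x α (Complex.I • β) - z.im • sp.solder x α β := by
    intro z α β
    rw [smul_comm, solder_smul_right, smul_smul Complex.I Complex.I, Complex.I_mul_I,
      neg_one_smul, _root_.map_neg]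
    module
  have l := fun z ↦ sp.solder_smul_left x z
  have r := fun z ↦ sp.solder_smul_right x z
  subst ho hι
  funext j
  fin_cases j <;>
    simp only [tetradVariation, tetrad, reVec, imVec, _root_.map_sub, LinearMap.sub_apply,
      l w₀₀, l w₀₁, l w₁₁, r w₀₀, r w₀₁, r w₁₁, solder_self_I, e1, e2, smul_sub, Fin.mk_zero,
      Fin.mk_one, Fin.reduceFinMk, Matrix.cons_val, Fin.isValue, Matrix.cons_val_zero,
      Matrix.cons_val_one, sp.solder_symm x (ι x) (o x), Complex.I_re, Complex.I_im] <;>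
    module

/-- The components `eps(∇_v α, β)` of the connection. -/
def conn (sp : SpinStructure S g) (nabla : CovariantDerivative (𝓡 4) SpinorModel S)
    (α β : Π x : M, S x) (x : M) (v : TangentSpace (𝓡 4) x) : ℂ :=
  sp.eps x (nabla α x v) (β x)

/-- The components `eps(R(X,Y) α, β)` of the spinor curvature. -/
def curv (sp : SpinStructure S g) (nabla : CovariantDerivative (𝓡 4) SpinorModel S)
    (X Y : Π x : M, TangentSpace (𝓡 4) x) (α β : Π x : M, S x) (x : M) : ℂ :=
  sp.eps x (nabla.curvature X Y α x) (β x)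

theorem curv_swap (nabla : CovariantDerivative (𝓡 4) SpinorModel S)
    (X Y : Π x : M, TangentSpace (𝓡 4) x) (α β : Π x : M, S x) (x : M) :
    sp.curv nabla Y X α β x = - sp.curv nabla X Y α β x := by
  rw [curv, CovariantDerivative.curvature_swap, _root_.map_neg]
  rfl

namespace IsSpinFrame

variable {D : CovariantDerivative (𝓡 4) E4 (TangentSpace (𝓡 4) : M → Type _)}
  {nabla : CovariantDerivative (𝓡 4) SpinorModel S} {U : Set M} {o ι : Π x : M, S x}
  (F : sp.IsSpinFrame D nabla U o ι)
  {α β : Π x : M, S x} {X Y Z : Π x : M, TangentSpace (𝓡 4) x} {x : M}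

include F

theorem smooth_o : SmoothSectionOn SpinorModel U o := F.dyad.smooth_fst

theorem smooth_ι : SmoothSectionOn SpinorModel U ι := F.dyad.smooth_snd

theorem smooth_nabla (hα : SmoothSectionOn SpinorModel U α) (hX : SmoothSectionOn E4 U X) :
    SmoothSectionOn SpinorModel U (fun y ↦ nabla α y (X y)) :=
  CovariantDerivative.smooth_apply (F.spin.smooth U F.isOpen) F.isOpen hα hX

theorem smooth_curvature (hX : SmoothSectionOn E4 U X) (hY : SmoothSectionOn E4 U Y)
    (hα : SmoothSectionOn SpinorModel U α) :
    SmoothSectionOn SpinorModel U (nabla.curvature X Y α) :=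
  CovariantDerivative.smooth_curvature (F.spin.smooth U F.isOpen) F.isOpen hα hX hY

theorem smooth_solder (hα : SmoothSectionOn SpinorModel U α)
    (hβ : SmoothSectionOn SpinorModel U β) :
    SmoothSectionOn E4 U (fun y ↦ sp.solder y (α y) (β y)) :=
  fun x hx ↦ sp.solder_smooth x α β (hα x hx) (hβ x hx)

theorem smooth_tetrad (i : Fin 4) : SmoothSectionOn E4 U (sp.tetrad o ι i) := by
  have hI : SmoothSectionOn SpinorModel U (fun y ↦ Complex.I • ι y) :=
    fun x hx ↦ SmoothSpinorAt.smul_I (F.smooth_ι x hx)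
  fin_cases i
  exacts [F.smooth_solder F.smooth_o F.smooth_o, F.smooth_solder F.smooth_ι F.smooth_ι,
    F.smooth_solder F.smooth_o F.smooth_ι, F.smooth_solder F.smooth_o hI]

theorem inner_tetrad (hx : x ∈ U) (i j : Fin 4) :
    g.inner x (sp.tetrad o ι i x) (sp.tetrad o ι j x) = tetradGram i j :=
  sp.inner_tetrad (F.dyad.normalized x hx) i j

theorem tetrad_zero_ne_zero (hx : x ∈ U) : sp.tetrad o ι 0 x ≠ 0 := by
  intro h
  have h2 := F.inner_tetrad hx 0 1
  rw [h, _root_.map_zero] at h2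
  simp [tetradGram] at h2

theorem mvfderiv_eps (hα : SmoothSectionOn SpinorModel U α) (hβ : SmoothSectionOn SpinorModel U β)
    (hx : x ∈ U) (v : TangentSpace (𝓡 4) x) :
    mvfderiv (𝓡 4) (fun y ↦ sp.eps y (α y) (β y)) x v
      = sp.eps x (nabla α x v) (β x) + sp.eps x (α x) (nabla β x v) :=
  F.spin.eps_parallel x α β (hα x hx) (hβ x hx) v

theorem mdiff_eps (hα : SmoothSectionOn SpinorModel U α) (hβ : SmoothSectionOn SpinorModel U β)
    (hx : x ∈ U) :
    MDifferentiableAt (𝓡 4) 𝓘(ℝ, ℂ) (fun y ↦ sp.eps y (α y) (β y)) x :=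
  (sp.eps_smooth x α β (hα x hx) (hβ x hx)).mdifferentiableAt (by simp)

/-- The curvature of the spin connection preserves `eps`. -/
theorem curv_symm (hX : SmoothSectionOn E4 U X) (hY : SmoothSectionOn E4 U Y)
    (hα : SmoothSectionOn SpinorModel U α) (hβ : SmoothSectionOn SpinorModel U β) (hx : x ∈ U) :
    sp.curv nabla X Y β α x = sp.curv nabla X Y α β x := by
  have e : ∀ A : Π x : M, TangentSpace (𝓡 4) x, ∀ᶠ y in 𝓝 x,
      mvfderiv (𝓡 4) (fun y ↦ sp.eps y (α y) (β y)) y (A y)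
        = sp.eps y (nabla α y (A y)) (β y) + sp.eps y (α y) (nabla β y (A y)) := fun A ↦ by
    filter_upwards [F.isOpen.mem_nhds hx] with y hy
    exact F.mvfderiv_eps hα hβ hy _
  have hd : ∀ {A : Π x : M, TangentSpace (𝓡 4) x}, SmoothSectionOn E4 U A →
      MDifferentiableAt (𝓡 4) 𝓘(ℝ, ℂ) (fun y ↦ sp.eps y (nabla α y (A y)) (β y)) x ∧
      MDifferentiableAt (𝓡 4) 𝓘(ℝ, ℂ) (fun y ↦ sp.eps y (α y) (nabla β y (A y))) x :=
    fun hA ↦ ⟨F.mdiff_eps (F.smooth_nabla hα hA) hβ hx, F.mdiff_eps hα (F.smooth_nabla hβ hA) hx⟩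
  have key : ∀ {A : Π x : M, TangentSpace (𝓡 4) x}, SmoothSectionOn E4 U A → ∀ v,
      mvfderiv (𝓡 4) (fun y ↦ mvfderiv (𝓡 4) (fun y ↦ sp.eps y (α y) (β y)) y (A y)) x v
        = (sp.eps x (nabla (fun y ↦ nabla α y (A y)) x v) (β x)
            + sp.eps x (nabla α x (A x)) (nabla β x v))
          + (sp.eps x (nabla α x v) (nabla β x (A x))
            + sp.eps x (α x) (nabla (fun y ↦ nabla β y (A y)) x v)) := by
    intro A hA v
    rw [mvfderiv_congr (e A), show (fun y ↦ sp.eps y (nabla α y (A y)) (β y)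
      + sp.eps y (α y) (nabla β y (A y))) = (fun y ↦ sp.eps y (nabla α y (A y)) (β y))
      + fun y ↦ sp.eps y (α y) (nabla β y (A y)) from rfl, mvfderiv_add (hd hA).1 (hd hA).2,
      ← F.mvfderiv_eps (F.smooth_nabla hα hA) hβ hx, ← F.mvfderiv_eps hα (F.smooth_nabla hβ hA) hx]
    rfl
  have h := mvfderiv_commutator_complex F.isOpen
    (fun y hy ↦ sp.eps_smooth y α β (hα y hy) (hβ y hy)) hX hY (F.smooth_tetrad 0) hx
    (F.tetrad_zero_ne_zero hx)
    (((hd hX).1.add (hd hX).2).congr_of_eventuallyEq (e X))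
    (((hd hY).1.add (hd hY).2).congr_of_eventuallyEq (e Y))
  rw [key hX, key hY, F.mvfderiv_eps hα hβ hx] at h
  simp only [curv, CovariantDerivative.curvature, _root_.map_sub, LinearMap.sub_apply]
  rw [sp.eps_swap x (α x), sp.eps_swap x (α x) (nabla _ x (Y x)), sp.eps_swap x (α x) (nabla β x _)]
  linear_combination -h

theorem conn_symm (hx : x ∈ U) (v : TangentSpace (𝓡 4) x) :
    sp.conn nabla ι o x v = sp.conn nabla o ι x v := by
  have h := F.mvfderiv_eps F.smooth_o F.smooth_ι hx v
  rw [mvfderiv_congr (g := fun _ ↦ 1), mvfderiv_const] at h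
  · simp only [conn]
    rw [sp.eps_swap x (o x)]
    simp at h
    linear_combination h
  · filter_upwards [F.isOpen.mem_nhds hx] with y hy using F.dyad.normalized y hy

theorem nabla_o (hx : x ∈ U) (v : TangentSpace (𝓡 4) x) :
    nabla o x v = sp.conn nabla o ι x v • o x - sp.conn nabla o o x v • ι x := by
  conv_lhs => rw [sp.dyad_expand (F.dyad.normalized x hx) (nabla o x v), sp.eps_swap x _ (o x)]
  simp only [conn]
  module

theorem nabla_ι (hx : x ∈ U) (v : TangentSpace (𝓡 4) x) :
    nabla ι x v = sp.conn nabla ι ι x v • o x - sp.conn nabla o ι x v • ι x := by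
  rw [← F.conn_symm hx]
  conv_lhs => rw [sp.dyad_expand (F.dyad.normalized x hx) (nabla ι x v), sp.eps_swap x _ (o x)]
  simp only [conn]
  module

theorem curvature_o (hx : x ∈ U) :
    nabla.curvature X Y o x
      = sp.curv nabla X Y o ι x • o x - sp.curv nabla X Y o o x • ι x := by
  conv_lhs => rw [sp.dyad_expand (F.dyad.normalized x hx) (nabla.curvature X Y o x),
    sp.eps_swap x _ (o x)]
  simp only [curv]
  module

theorem curvature_ι (hX : SmoothSectionOn E4 U X) (hY : SmoothSectionOn E4 U Y) (hx : x ∈ U) :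
    nabla.curvature X Y ι x
      = sp.curv nabla X Y ι ι x • o x - sp.curv nabla X Y o ι x • ι x := by
  rw [← F.curv_symm hX hY F.smooth_o F.smooth_ι hx]
  conv_lhs => rw [sp.dyad_expand (F.dyad.normalized x hx) (nabla.curvature X Y ι x),
    sp.eps_swap x _ (o x)]
  simp only [curv]
  module

theorem curvature_smul_I (hX : SmoothSectionOn E4 U X) (hY : SmoothSectionOn E4 U Y)
    (hα : SmoothSectionOn SpinorModel U α) (hx : x ∈ U) :
    nabla.curvature X Y (fun y ↦ Complex.I • α y) x = Complex.I • nabla.curvature X Y α x := by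
  have key : ∀ {A : Π x : M, TangentSpace (𝓡 4) x}, SmoothSectionOn E4 U A → ∀ v,
      nabla (fun y ↦ nabla (fun y ↦ Complex.I • α y) y (A y)) x v
        = Complex.I • nabla (fun y ↦ nabla α y (A y)) x v := by
    intro A hA v
    rw [← F.spin.smul_I x _ (F.smooth_nabla hα hA x hx)]
    rw [nabla.congr_section F.isOpen (F.smooth_nabla 
      (fun y hy ↦ SmoothSpinorAt.smul_I (hα y hy)) hA)
      (fun y hy ↦ SmoothSpinorAt.smul_I (F.smooth_nabla hα hA y hy))
      (fun y hy ↦ F.spin.smul_I y α (hα y hy) (A y)) hx]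
  simp only [CovariantDerivative.curvature, smul_sub]
  rw [key hX, key hY, F.spin.smul_I x α (hα x hx)]

theorem curvature_solder (hX : SmoothSectionOn E4 U X) (hY : SmoothSectionOn E4 U Y)
    (hα : SmoothSectionOn SpinorModel U α) (hβ : SmoothSectionOn SpinorModel U β) (hx : x ∈ U) :
    D.curvature X Y (fun y ↦ sp.solder y (α y) (β y)) x
      = sp.solder x (nabla.curvature X Y α x) (β x)
        + sp.solder x (α x) (nabla.curvature X Y β x) := by
  have hp : ∀ {γ δ : Π x : M, S x}, SmoothSectionOn SpinorModel U γ →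
      SmoothSectionOn SpinorModel U δ → ∀ y ∈ U, ∀ v,
      D (fun y ↦ sp.solder y (γ y) (δ y)) y v
        = sp.solder y (nabla γ y v) (δ y) + sp.solder y (γ y) (nabla δ y v) :=
    fun hγ hδ y hy v ↦ F.spin.solder_parallel y _ _ (hγ y hy) (hδ y hy) v
  have key : ∀ {A : Π x : M, TangentSpace (𝓡 4) x}, SmoothSectionOn E4 U A → ∀ v,
      D (fun y ↦ D (fun y ↦ sp.solder y (α y) (β y)) y (A y)) x v
        = (sp.solder x (nabla (fun y ↦ nabla α y (A y)) x v) (β x)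
            + sp.solder x (nabla α x (A x)) (nabla β x v))
          + (sp.solder x (nabla α x v) (nabla β x (A x))
            + sp.solder x (α x) (nabla (fun y ↦ nabla β y (A y)) x v)) := by
    intro A hA v
    have s1 := F.smooth_solder (F.smooth_nabla hα hA) hβ
    have s2 := F.smooth_solder hα (F.smooth_nabla hβ hA)
    rw [D.congr_section F.isOpen (CovariantDerivative.smooth_apply
      (F.leviCivita.smooth U F.isOpen) F.isOpen (F.smooth_solder hα hβ) hA)
      (fun y hy ↦ ContMDiffAt.add_section (s1 y hy) (s2 y hy))
      (fun y hy ↦ hp hα hβ y hy (A y)) hx]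
    exact (D.map_add s1 s2 hx v).trans (by
      rw [hp (F.smooth_nabla hα hA) hβ x hx, hp hα (F.smooth_nabla hβ hA) x hx])
  simp only [CovariantDerivative.curvature, _root_.map_sub, LinearMap.sub_apply]
  rw [key hX, key hY, hp hα hβ x hx]
  abel

/-- The covariant derivative of the tetrad. -/
theorem deriv_tetrad (hx : x ∈ U) (j : Fin 4) (v : TangentSpace (𝓡 4) x) :
    D (sp.tetrad o ι j) x v = tetradVariation (sp.conn nabla o o x v) (sp.conn nabla o ι x v)
      (sp.conn nabla ι ι x v) (fun k ↦ sp.tetrad o ι k x) j := by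
  rw [tetradVariation_eq o ι x (F.nabla_o hx v) (F.nabla_ι hx v), ← F.spin.smul_I x ι
    (F.smooth_ι x hx)]
  have hI : SmoothSpinorAt (fun y ↦ Complex.I • ι y) x := SmoothSpinorAt.smul_I (F.smooth_ι x hx)
  fin_cases j
  exacts [F.spin.solder_parallel x _ _ (F.smooth_o x hx) (F.smooth_o x hx) v,
    F.spin.solder_parallel x _ _ (F.smooth_ι x hx) (F.smooth_ι x hx) v,
    F.spin.solder_parallel x _ _ (F.smooth_o x hx) (F.smooth_ι x hx) v,
    F.spin.solder_parallel x _ _ (F.smooth_o x hx) hI v]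

/-- The Riemann curvature of the tetrad. -/
theorem curvature_tetrad (hX : SmoothSectionOn E4 U X) (hY : SmoothSectionOn E4 U Y) (hx : x ∈ U)
    (j : Fin 4) :
    D.curvature X Y (sp.tetrad o ι j) x = tetradVariation (sp.curv nabla X Y o o x)
      (sp.curv nabla X Y o ι x) (sp.curv nabla X Y ι ι x) (fun k ↦ sp.tetrad o ι k x) j := by
  rw [tetradVariation_eq o ι x (F.curvature_o hx) (F.curvature_ι hX hY hx),
    ← F.curvature_smul_I hX hY F.smooth_ι hx]
  have hI : SmoothSectionOn SpinorModel U (fun y ↦ Complex.I • ι y) :=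
    fun x hx ↦ SmoothSpinorAt.smul_I (F.smooth_ι x hx)
  fin_cases j
  exacts [F.curvature_solder hX hY F.smooth_o F.smooth_o hx,
    F.curvature_solder hX hY F.smooth_ι F.smooth_ι hx,
    F.curvature_solder hX hY F.smooth_o F.smooth_ι hx,
    F.curvature_solder hX hY F.smooth_o hI hx]

end IsSpinFrame

end SpinStructure

end Spinors

section Algebra

/-- The inner products of `tetradVariation w₀₀ w₀₁ w₁₁` with the tetrad. -/
def tetradCurvature (w₀₀ w₀₁ w₁₁ : ℂ) : Matrix (Fin 4) (Fin 4) ℝ :=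
  !![0, 2 * w₀₁.re, w₀₀.re, w₀₀.im; -(2 * w₀₁.re), 0, -w₁₁.re, w₁₁.im;
    -w₀₀.re, w₁₁.re, 0, w₀₁.im; -w₀₀.im, -w₁₁.im, -w₀₁.im, 0]

/-- The components of the spinor curvature of an Einstein metric in the real tetrad: the
mixed part vanishes, the rest is symmetric and its trace is the cosmological constant. -/
structure IsEinsteinCurvature (Λ : ℝ) (H₀₀ H₀₁ H₁₁ : Fin 4 → Fin 4 → ℂ) : Prop where
  lq₀₀ : H₀₀ 0 3 = -(Complex.I * H₀₀ 0 2)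
  nq₀₀ : H₀₀ 1 3 = Complex.I * H₀₀ 1 2
  pq₀₀ : 2 * H₀₀ 2 3 = -(Complex.I * H₀₀ 0 1)
  lq₀₁ : H₀₁ 0 3 = -(Complex.I * H₀₁ 0 2)
  nq₀₁ : H₀₁ 1 3 = Complex.I * H₀₁ 1 2
  pq₀₁ : 2 * H₀₁ 2 3 = -(Complex.I * H₀₁ 0 1)
  lq₁₁ : H₁₁ 0 3 = -(Complex.I * H₁₁ 0 2)
  nq₁₁ : H₁₁ 1 3 = Complex.I * H₁₁ 1 2
  pq₁₁ : 2 * H₁₁ 2 3 = -(Complex.I * H₁₁ 0 1)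
  symm₀₁ : H₀₀ 0 1 = 2 * H₀₁ 0 2
  symm₀₂ : H₁₁ 0 2 = -H₀₀ 1 2
  symm₁₂ : H₁₁ 0 1 = -(2 * H₀₁ 1 2)
  trace : 2 * H₁₁ 0 2 - H₀₁ 0 1 = 3 * Λ

theorem IsEinsteinCurvature.of_bianchi_ricci {Λ : ℝ} {H₀₀ H₀₁ H₁₁ : Fin 4 → Fin 4 → ℂ}
    (h₀₀ : ∀ i j, H₀₀ j i = -H₀₀ i j) (h₀₁ : ∀ i j, H₀₁ j i = -H₀₁ i j)
    (h₁₁ : ∀ i j, H₁₁ j i = -H₁₁ i j)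
    (hB : ∀ i j k m, tetradCurvature (H₀₀ i j) (H₀₁ i j) (H₁₁ i j) k m
      + tetradCurvature (H₀₀ j k) (H₀₁ j k) (H₁₁ j k) i m
      + tetradCurvature (H₀₀ k i) (H₀₁ k i) (H₁₁ k i) j m = 0)
    (hR : ∀ i j, tetradCurvature (H₀₀ i 0) (H₀₁ i 0) (H₁₁ i 0) j 1
      + tetradCurvature (H₀₀ i 1) (H₀₁ i 1) (H₁₁ i 1) j 0
      - 2 * tetradCurvature (H₀₀ i 2) (H₀₁ i 2) (H₁₁ i 2) j 2
      - 2 * tetradCurvature (H₀₀ i 3) (H₀₁ i 3) (H₁₁ i 3) j 3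
      = 6 * Λ * SpinStructure.tetradGram i j) :
    IsEinsteinCurvature Λ H₀₀ H₀₁ H₁₁ := by
  have z : ∀ {H : Fin 4 → Fin 4 → ℂ}, (∀ i j, H j i = -H i j) → ∀ i, H i i = 0 :=
    fun h i ↦ self_eq_neg.1 (h i i)
  have hB0120 := hB 0 1 2 0
  have hB0121 := hB 0 1 2 1
  have hB0122 := hB 0 1 2 2
  have hB0123 := hB 0 1 2 3
  have hB0130 := hB 0 1 3 0
  have hB0131 := hB 0 1 3 1
  have hB0132 := hB 0 1 3 2
  have hB0133 := hB 0 1 3 3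
  have hB0230 := hB 0 2 3 0
  have hB0231 := hB 0 2 3 1
  have hB0232 := hB 0 2 3 2
  have hB0233 := hB 0 2 3 3
  have hB1230 := hB 1 2 3 0
  have hB1231 := hB 1 2 3 1
  have hB1232 := hB 1 2 3 2
  have hB1233 := hB 1 2 3 3
  have hR00 := hR 0 0
  have hR01 := hR 0 1
  have hR02 := hR 0 2
  have hR03 := hR 0 3
  have hR10 := hR 1 0
  have hR11 := hR 1 1
  have hR12 := hR 1 2
  have hR13 := hR 1 3
  have hR22 := hR 2 2
  have hR23 := hR 2 3
  have hR32 := hR 3 2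
  have hR33 := hR 3 3
  simp only [tetradCurvature, SpinStructure.tetradGram, Matrix.of_apply, Matrix.cons_val,
    Matrix.cons_val_zero, Matrix.cons_val_one, Fin.isValue, z h₀₀, z h₀₁, z h₁₁,
    h₀₀ 0 1, h₀₁ 0 1, h₁₁ 0 1, h₀₀ 0 2, h₀₁ 0 2, h₁₁ 0 2, h₀₀ 0 3, h₀₁ 0 3, h₁₁ 0 3,
    h₀₀ 1 2, h₀₁ 1 2, h₁₁ 1 2, h₀₀ 1 3, h₀₁ 1 3, h₁₁ 1 3, h₀₀ 2 3, h₀₁ 2 3, h₁₁ 2 3,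
    Complex.neg_re, Complex.neg_im, Complex.zero_re, Complex.zero_im]
    at hB0120 hB0121 hB0122 hB0123 hB0130 hB0131 hB0132 hB0133 hB0230 hB0231 hB0232 hB0233 hB1230
      hB1231 hB1232 hB1233 hR00 hR01 hR02 hR03 hR10 hR11 hR12 hR13 hR22 hR23 hR32 hR33
  constructor
  · apply Complex.ext
    · simp
      linear_combination hB0230
    · simp
      linear_combination -(1 / 2) * hR00
  · apply Complex.ext
    · simp
      linear_combination (1 / 2) * hB0123 + (1 / 2) * hB0132 + (1 / 2) * hR23 + (1 / 2) * hR32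
    · simp
      linear_combination -(1 / 2) * hB0122 + (1 / 2) * hB0133 - (1 / 2) * hR22 + (1 / 2) * hR33
  · apply Complex.ext
    · simp
      linear_combination 2 * hB0232 + hR03
    · simp
      linear_combination 2 * hB0233 - hR02
  · apply Complex.ext
    · simp
      linear_combination (1 / 2) * hB0130 - (1 / 2) * hR03
    · simp
      linear_combination (1 / 2) * hB0120 - (1 / 2) * hR02
  · apply Complex.ext
    · simp
      linear_combination (1 / 2) * hB0131 + (1 / 2) * hR13
    · simp
      linear_combination -(1 / 2) * hB0121 - (1 / 2) * hR12
  · apply Complex.ext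
    · simp
      linear_combination -(1 / 2) * hB0123 + (1 / 2) * hB0132 + (1 / 2) * hB0231 - (1 / 2) * hB1230
    · simp
      linear_combination -(1 / 4) * hR01 - (1 / 4) * hR10 - (1 / 2) * hR22 - (1 / 2) * hR33
  · apply Complex.ext
    · simp
      linear_combination (1 / 2) * hB0123 + (1 / 2) * hB0132 - (1 / 2) * hR23 - (1 / 2) * hR32
    · simp
      linear_combination (1 / 2) * hB0122 - (1 / 2) * hB0133 - (1 / 2) * hR22 + (1 / 2) * hR33
  · apply Complex.ext
    · simp
      linear_combination -hB1231
    · simp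
      linear_combination -(1 / 2) * hR11
  · apply Complex.ext
    · simp
      linear_combination -2 * hB1232 - hR13
    · simp
      linear_combination 2 * hB1233 - hR12
  · apply Complex.ext
    · simp
      linear_combination -hB0120
    · simp
      linear_combination -hR03
  · apply Complex.ext
    · simp
      linear_combination hB0122
    · simp
      linear_combination hR23
  · apply Complex.ext
    · simp
      linear_combination hB0121
    · simp
      linear_combination hR13
  · apply Complex.ext
    · simp
      linear_combination (1 / 2) * hB0122 - (1 / 2) * hB0133 + (1 / 2) * hR01 - (1 / 2) * hR22 + (1 / 2) * hR33
    · simp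
      linear_combination -hB0123 + hR23

end Algebra

section Spinors

variable {M : Type*} [TopologicalSpace M] [ChartedSpace E4 M] [IsManifold (𝓡 4) ∞ M]
  {S : M → Type*} [TopologicalSpace (TotalSpace SpinorModel S)]
  [∀ x, AddCommGroup (S x)] [∀ x, Module ℂ (S x)] [∀ x, TopologicalSpace (S x)]
  [∀ x, IsTopologicalAddGroup (S x)] [∀ x, ContinuousSMul ℝ (S x)]
  [FiberBundle SpinorModel S] [VectorBundle ℝ SpinorModel S] [VectorBundle ℂ SpinorModel S]
  [ContMDiffVectorBundle ∞ SpinorModel S (𝓡 4)]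

namespace SpinStructure

variable {g : LorentzMetric M} {sp : SpinStructure S g}

theorem map_tetradVariation {V W : Type*} [AddCommGroup V] [Module ℝ V] [AddCommGroup W]
    [Module ℝ W] (L : V →ₗ[ℝ] W) (w₀₀ w₀₁ w₁₁ : ℂ) (E : Fin 4 → V) (j : Fin 4) :
    L (tetradVariation w₀₀ w₀₁ w₁₁ E j) = tetradVariation w₀₀ w₀₁ w₁₁ (fun k ↦ L (E k)) j := by
  fin_cases j <;> simp [tetradVariation]

/-- The orthonormal tetrad obtained from `tetrad`, where `c² = 1 / 2`. -/
def orthonormalize {V : Type*} [AddCommGroup V] [Module ℝ V] (c : ℝ) (E : Fin 4 → V) : Fin 4 → V :=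
  ![c • (E 0 + E 1), c • (E 0 + (-1 : ℝ) • E 1), (2 * c) • E 2, (2 * c) • E 3]

section Orthonormalize

variable {V : Type*} [AddCommGroup V] [Module ℝ V] [TopologicalSpace V]
  (b : V →L[ℝ] V →L[ℝ] ℝ) {E : Fin 4 → V} {c : ℝ} (hc : c * c = 1 / 2)

include hc

theorem isOrthonormalTetrad_orthonormalize (hE : ∀ i j, b (E i) (E j) = tetradGram i j) :
    IsOrthonormalTetrad (fun v w ↦ b v w) (orthonormalize c E) := by
  have hc' : c ^ 2 = 1 / 2 := by rw [← hc]; ring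
  intro i j
  fin_cases i <;> fin_cases j <;>
    simp [orthonormalize, hE, tetradGram, minkowskiSign] <;> ring_nf <;> norm_num [hc']

theorem sum_orthonormalize (L : V →ₗ[ℝ] V) :
    ∑ i, minkowskiSign i * b (L (orthonormalize c E i)) (orthonormalize c E i)
      = b (L (E 0)) (E 1) + b (L (E 1)) (E 0) - 2 * b (L (E 2)) (E 2) - 2 * b (L (E 3)) (E 3) := by
  simp only [Fin.sum_univ_four, orthonormalize, minkowskiSign, Matrix.cons_val,
    Matrix.cons_val_zero, Matrix.cons_val_one, _root_.map_add, map_smul, _root_.add_apply,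
    _root_.smul_apply, smul_eq_mul]
  simp
  linear_combination (2 * b (L (E 0)) (E 1) + 2 * b (L (E 1)) (E 0) - 4 * b (L (E 2)) (E 2)
    - 4 * b (L (E 3)) (E 3)) * hc

end Orthonormalize

namespace IsSpinFrame

variable {D : CovariantDerivative (𝓡 4) E4 (TangentSpace (𝓡 4) : M → Type _)}
  {nabla : CovariantDerivative (𝓡 4) SpinorModel S} {U : Set M} {o ι : Π x : M, S x}
  (F : sp.IsSpinFrame D nabla U o ι)
  {α β : Π x : M, S x} {X Y Z : Π x : M, TangentSpace (𝓡 4) x} {x : M}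

include F

theorem inner_tetradVariation (hx : x ∈ U) (w₀₀ w₀₁ w₁₁ : ℂ) (k m : Fin 4) :
    g.inner x (tetradVariation w₀₀ w₀₁ w₁₁ (fun j ↦ sp.tetrad o ι j x) k) (sp.tetrad o ι m x)
      = tetradCurvature w₀₀ w₀₁ w₁₁ k m := by
  have h := fun i ↦ F.inner_tetrad hx i m
  let L : TangentSpace (𝓡 4) x →ₗ[ℝ] ℝ :=
    { toFun := fun v ↦ g.inner x v (sp.tetrad o ι m x)
      map_add' := fun v w ↦ by simp
      map_smul' := fun c v ↦ by simp }
  have e := map_tetradVariation L w₀₀ w₀₁ w₁₁ (fun j ↦ sp.tetrad o ι j x) k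
  refine e.trans ?_
  simp only [L, LinearMap.coe_mk, AddHom.coe_mk, h]
  fin_cases k <;> fin_cases m <;> simp [tetradVariation, tetradCurvature, tetradGram] <;> ring

/-- At a point, the curvature of a covariant derivative is a linear map in its first vector
argument. -/
theorem exists_curvature_hom {V : M → Type*} {E : Type*} [NormedAddCommGroup E] [NormedSpace ℝ E]
    [TopologicalSpace (TotalSpace E V)]
    [∀ x, AddCommGroup (V x)] [∀ x, Module ℝ (V x)] [∀ x, TopologicalSpace (V x)]
    [∀ x, IsTopologicalAddGroup (V x)] [∀ x, ContinuousSMul ℝ (V x)] [FiberBundle E V]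
    [VectorBundle ℝ E V] {cov : CovariantDerivative (𝓡 4) E V}
    (hcov : ContMDiffCovariantDerivativeOn E ∞ cov.toFun U) {σ : Π x : M, V x}
    (hσ : SmoothSectionOn E U σ) (hx : x ∈ U) :
    ∃ L : TangentSpace (𝓡 4) x →ₗ[ℝ] V x, ∀ X : Π x : M, TangentSpace (𝓡 4) x,
      SmoothSectionOn E4 U X → cov.curvature X Y σ x = L (X x) :=
  ⟨(TensorialAt.mkHom _ x (CovariantDerivative.curvature_tensorialAt (Y := Y) hcov F.isOpen hσ
    hx)).toLinearMap, fun _ hX ↦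
    (TensorialAt.mkHom_apply (Φ := fun X ↦ cov.curvature X Y σ x) _ (hX.mdiff hx)).symm⟩

theorem tetradCurvature_bianchi (hx : x ∈ U) (i j k m : Fin 4) :
    let R := fun i j ↦ tetradCurvature
      (sp.curv nabla (sp.tetrad o ι i) (sp.tetrad o ι j) o o x)
      (sp.curv nabla (sp.tetrad o ι i) (sp.tetrad o ι j) o ι x)
      (sp.curv nabla (sp.tetrad o ι i) (sp.tetrad o ι j) ι ι x)
    R i j k m + R j k i m + R k i j m = 0 := by
  have s := F.smooth_tetrad
  have h := congrArg (fun v ↦ g.inner x v (sp.tetrad o ι m x))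
    (CovariantDerivative.first_bianchi (F.leviCivita.smooth U F.isOpen)
      F.leviCivita.torsion_free F.isOpen (s i) (s j) (s k) hx)
  simp only [F.curvature_tetrad (s _) (s _) hx, _root_.map_add, _root_.add_apply,
    F.inner_tetradVariation hx, _root_.map_zero, _root_.zero_apply] at h
  exact h

theorem tetradCurvature_ricci {Λ : ℝ} (hE : g.IsEinstein D Λ) (hx : x ∈ U) (i j : Fin 4) :
    let R := fun i j ↦ tetradCurvature
      (sp.curv nabla (sp.tetrad o ι i) (sp.tetrad o ι j) o o x)
      (sp.curv nabla (sp.tetrad o ι i) (sp.tetrad o ι j) o ι x)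
      (sp.curv nabla (sp.tetrad o ι i) (sp.tetrad o ι j) ι ι x)
    R i 0 j 1 + R i 1 j 0 - 2 * R i 2 j 2 - 2 * R i 3 j 3 = 6 * Λ * tetradGram i j := by
  have s := F.smooth_tetrad
  obtain ⟨c, hc⟩ : ∃ c : ℝ, c * c = 1 / 2 :=
    ⟨√(1 / 2), Real.mul_self_sqrt (by norm_num)⟩
  let e : Fin 4 → Π x : M, TangentSpace (𝓡 4) x :=
    fun k y ↦ orthonormalize c (fun l ↦ sp.tetrad o ι l y) k
  have he : ∀ i, SmoothSectionOn E4 U (e i) := by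
    intro i y hy
    fin_cases i
    · exact ContMDiffAt.const_smul_section (ContMDiffAt.add_section (s 0 y hy) (s 1 y hy))
    · exact ContMDiffAt.const_smul_section (ContMDiffAt.add_section (s 0 y hy)
        (ContMDiffAt.const_smul_section (s 1 y hy)))
    · exact ContMDiffAt.const_smul_section (s 2 y hy)
    · exact ContMDiffAt.const_smul_section (s 3 y hy)
  have hg := F.inner_tetrad hx
  have h := hE x e (sp.tetrad o ι i) (sp.tetrad o ι j) (fun k ↦ he k x hx) (s i x hx) (s j x hx)
    (isOrthonormalTetrad_orthonormalize (g.inner x) hc hg)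
  obtain ⟨L, hL⟩ := F.exists_curvature_hom (Y := sp.tetrad o ι i)
    (F.leviCivita.smooth U F.isOpen) (s j) hx
  have hL' : ∀ k, (-L) (sp.tetrad o ι k x) = D.curvature (sp.tetrad o ι i) (sp.tetrad o ι k)
      (sp.tetrad o ι j) x := fun k ↦ by
    rw [LinearMap.neg_apply, ← hL _ (s k), ← CovariantDerivative.curvature_swap]
  have hR : ∀ k, D.curvature (sp.tetrad o ι i) (e k) (sp.tetrad o ι j) x = (-L) (e k x) :=
    fun k ↦ by rw [LinearMap.neg_apply, ← hL _ (he k), ← CovariantDerivative.curvature_swap]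
  have h2 := sum_orthonormalize (g.inner x) (E := fun l ↦ sp.tetrad o ι l x) hc (-L)
  simp only [LorentzMetric.ricci, hR] at h
  rw [hg] at h
  rw [← h]
  refine Eq.trans ?_ h2.symm
  simp only [hL', F.curvature_tetrad (s i) (s _) hx, F.inner_tetradVariation hx]

/-- The curvature of an Einstein metric in the tetrad. -/
theorem isEinsteinCurvature {Λ : ℝ} (hE : g.IsEinstein D Λ) (hx : x ∈ U) :
    IsEinsteinCurvature Λ
      (fun i j ↦ sp.curv nabla (sp.tetrad o ι i) (sp.tetrad o ι j) o o x)
      (fun i j ↦ sp.curv nabla (sp.tetrad o ι i) (sp.tetrad o ι j) o ι x)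
      (fun i j ↦ sp.curv nabla (sp.tetrad o ι i) (sp.tetrad o ι j) ι ι x) :=
  .of_bianchi_ricci (fun _ _ ↦ curv_swap ..) (fun _ _ ↦ curv_swap ..) (fun _ _ ↦ curv_swap ..)
    (F.tetradCurvature_bianchi hx) (F.tetradCurvature_ricci hE hx)

theorem mlieBracket_tetrad (hx : x ∈ U) (i j : Fin 4) :
    mlieBracket (𝓡 4) (sp.tetrad o ι i) (sp.tetrad o ι j) x
      = D (sp.tetrad o ι j) x (sp.tetrad o ι i x) - D (sp.tetrad o ι i) x (sp.tetrad o ι j x) :=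
  (D.torsion_eq_zero_iff.1 F.leviCivita.torsion_free ((F.smooth_tetrad i).mdiff hx)
    ((F.smooth_tetrad j).mdiff hx)).symm

theorem curv_mlieBracket (hα : SmoothSectionOn SpinorModel U α) (hx : x ∈ U) (i j : Fin 4) :
    let w := fun i ↦ tetradVariation (sp.conn nabla o o x (sp.tetrad o ι i x))
      (sp.conn nabla o ι x (sp.tetrad o ι i x)) (sp.conn nabla ι ι x (sp.tetrad o ι i x))
      (fun m ↦ sp.curv nabla (sp.tetrad o ι m) Y α β x)
    sp.curv nabla (mlieBracket (𝓡 4) (sp.tetrad o ι i) (sp.tetrad o ι j)) Y α β x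
      = w i j - w j i := by
  have s := F.smooth_tetrad
  obtain ⟨L, hL⟩ := F.exists_curvature_hom (Y := Y) (F.spin.smooth U F.isOpen) hα hx
  let L' : TangentSpace (𝓡 4) x →ₗ[ℝ] ℂ :=
    ((sp.eps x).flip (β x)).restrictScalars ℝ ∘ₗ L
  have hL' : ∀ X : Π x : M, TangentSpace (𝓡 4) x, SmoothSectionOn E4 U X →
      sp.curv nabla X Y α β x = L' (X x) := fun X hX ↦ by
    rw [curv, hL X hX]
    rfl
  rw [hL' _ (CovariantDerivative.smooth_mlieBracket (s i) (s j)), F.mlieBracket_tetrad hx,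
    F.deriv_tetrad hx, F.deriv_tetrad hx, _root_.map_sub, map_tetradVariation,
    map_tetradVariation]
  simp only [hL' _ (s _)]

/-- The second Bianchi identity for the components of the spinor curvature. -/
theorem curv_bianchi (hα : SmoothSectionOn SpinorModel U α) (hβ : SmoothSectionOn SpinorModel U β)
    (hX : SmoothSectionOn E4 U X) (hY : SmoothSectionOn E4 U Y) (hZ : SmoothSectionOn E4 U Z)
    (hx : x ∈ U) :
    let B := fun X Y Z : Π x : M, TangentSpace (𝓡 4) x ↦
      mvfderiv (𝓡 4) (sp.curv nabla Y Z α β) x (X x)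
        - sp.eps x (nabla.curvature Y Z α x) (nabla β x (X x))
        - sp.eps x (nabla.curvature Y Z β x) (nabla α x (X x))
        - sp.curv nabla (mlieBracket (𝓡 4) X Y) Z α β x
    B X Y Z + B Y Z X + B Z X Y = 0 := by
  have h := congrArg (fun ψ ↦ sp.eps x ψ (β x)) (CovariantDerivative.second_bianchi
    (F.spin.smooth U F.isOpen) F.isOpen hα hX hY hZ hx)
  have key : ∀ {X Y Z : Π x : M, TangentSpace (𝓡 4) x}, SmoothSectionOn E4 U X →
      SmoothSectionOn E4 U Y → SmoothSectionOn E4 U Z →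
      sp.eps x (nabla (nabla.curvature Y Z α) x (X x)
        - nabla.curvature Y Z (fun y ↦ nabla α y (X y)) x
        - nabla.curvature (mlieBracket (𝓡 4) X Y) Z α x) (β x)
      = mvfderiv (𝓡 4) (sp.curv nabla Y Z α β) x (X x)
        - sp.eps x (nabla.curvature Y Z α x) (nabla β x (X x))
        - sp.eps x (nabla.curvature Y Z β x) (nabla α x (X x))
        - sp.curv nabla (mlieBracket (𝓡 4) X Y) Z α β x := by
    intro X Y Z hX hY hZ
    have h1 : mvfderiv (𝓡 4) (sp.curv nabla Y Z α β) x (X x) = _ :=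
      F.mvfderiv_eps (F.smooth_curvature hY hZ hα) hβ hx (X x)
    have h2 := F.curv_symm hY hZ (F.smooth_nabla hα hX) hβ hx
    simp only [curv] at h2 ⊢
    simp only [_root_.map_sub, LinearMap.sub_apply]
    linear_combination -h1 + h2
  simp only [_root_.map_add, LinearMap.add_apply, key hX hY hZ, key hY hZ hX, key hZ hX hY,
    _root_.map_zero, LinearMap.zero_apply] at h
  exact h

end IsSpinFrame

end SpinStructure

end Spinors

namespace TypeII

/-- The components `o^C o^D R_{abCD}` of the curvature of a type II Einstein spacetime in the
real tetrad. -/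
def curv₀₀ (W Λ : ℂ) : Matrix (Fin 4) (Fin 4) ℂ :=
  !![0, 0, 0, 0; 0, 0, -(W / 2 + Λ), -(Complex.I * (W / 2 + Λ));
    0, W / 2 + Λ, 0, 0; 0, Complex.I * (W / 2 + Λ), 0, 0]

/-- The components `o^C ι^D R_{abCD}` of the curvature of a type II Einstein spacetime. -/
def curv₀₁ (W T Λ : ℂ) : Matrix (Fin 4) (Fin 4) ℂ :=
  !![0, W - Λ, 0, 0; -(W - Λ), 0, -(T / 2), -(Complex.I * T / 2);
    0, T / 2, 0, -(Complex.I * (W - Λ) / 2); 0, Complex.I * T / 2, Complex.I * (W - Λ) / 2, 0]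

/-- The components `ι^C ι^D R_{abCD}` of the curvature of a type II Einstein spacetime. -/
def curv₁₁ (W T V Λ : ℂ) : Matrix (Fin 4) (Fin 4) ℂ :=
  !![0, T, W / 2 + Λ, -(Complex.I * (W / 2 + Λ)); -T, 0, V, Complex.I * V;
    -(W / 2 + Λ), -V, 0, -(Complex.I * T / 2);
    Complex.I * (W / 2 + Λ), -(Complex.I * V), Complex.I * T / 2, 0]

/-- The torsion-free bracket term in the second Bianchi identity. -/
def bracket (w₀₀ w₀₁ w₁₁ : Fin 4 → ℂ) (H : Matrix (Fin 4) (Fin 4) ℂ) (i j k : Fin 4) : ℂ :=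
  SpinStructure.tetradVariation (w₀₀ i) (w₀₁ i) (w₁₁ i) (fun m ↦ H m k) j
    - SpinStructure.tetradVariation (w₀₀ j) (w₀₁ j) (w₁₁ j) (fun m ↦ H m k) i

/-- The cyclic sum of `B` over its three indices. -/
def cyclicSum (B : Fin 4 → Fin 4 → Fin 4 → ℂ) (i j k : Fin 4) : ℂ :=
  B i j k + B j k i + B k i j

variable {W T V Λ : ℂ} {w₀₀ w₀₁ w₁₁ dW dT dV : Fin 4 → ℂ}

theorem exists_re_im (w : Fin 4 → ℂ) : ∃ r s : Fin 4 → ℝ, w = fun i ↦ r i + s i * Complex.I :=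
  ⟨fun i ↦ (w i).re, fun i ↦ (w i).im, funext fun _ ↦ (Complex.re_add_im _).symm⟩

theorem bianchi₀₀ (hW : W ≠ 0)
    (h : ∀ i j k, cyclicSum (fun i j k ↦ curv₀₀ (dW i) 0 j k
      - 2 * (curv₀₀ W Λ j k * w₀₁ i - curv₀₁ W T Λ j k * w₀₀ i)
      - bracket w₀₀ w₀₁ w₁₁ (curv₀₀ W Λ) i j k) i j k = 0) :
    w₀₀ 0 = 0 ∧ w₀₀ 2 + Complex.I * w₀₀ 3 = 0 := by
  obtain ⟨r, s, rfl⟩ := exists_re_im w₀₀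
  obtain ⟨r', s', rfl⟩ := exists_re_im w₀₁
  obtain ⟨r'', s'', rfl⟩ := exists_re_im w₁₁
  have h1 := h 0 2 3
  have h2 := h 0 1 2
  have h3 := h 0 1 3
  simp [cyclicSum, curv₀₀, curv₀₁, bracket, SpinStructure.tetradVariation] at h1 h2 h3
  constructor
  · refine (mul_eq_zero.1 (?_ : W * _ = 0)).resolve_left hW
    linear_combination (norm := (ring_nf; simp only [Complex.I_sq, Complex.I_pow_three]; ring)) (2 / 3 * Complex.I) * h1
  · refine (mul_eq_zero.1 (?_ : W * _ = 0)).resolve_left hW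
    linear_combination (norm := (ring_nf; simp only [Complex.I_sq, Complex.I_pow_three]; ring)) (1 / 3) * (h2 + Complex.I * h3)

theorem bianchi₀₁ (h0 : w₀₀ 0 = 0) (hm : w₀₀ 2 + Complex.I * w₀₀ 3 = 0)
    (h : ∀ i j k, cyclicSum (fun i j k ↦ curv₀₁ (dW i) (dT i) 0 j k
      - (curv₀₀ W Λ j k * w₁₁ i - curv₁₁ W T V Λ j k * w₀₀ i)
      - bracket w₀₀ w₀₁ w₁₁ (curv₀₁ W T Λ) i j k) i j k = 0) :
    dW 0 = 3 * W * (w₀₀ 2 - Complex.I * w₀₀ 3) ∧ dW 2 + Complex.I * dW 3 = 3 * W * w₀₀ 1 := by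
  obtain ⟨r, s, rfl⟩ := exists_re_im w₀₀
  obtain ⟨r', s', rfl⟩ := exists_re_im w₀₁
  obtain ⟨r'', s'', rfl⟩ := exists_re_im w₁₁
  have h1 := h 0 2 3
  have h2 := h 0 1 2
  have h3 := h 0 1 3
  simp only at h0 hm ⊢
  simp [cyclicSum, curv₀₀, curv₀₁, curv₁₁, bracket, SpinStructure.tetradVariation] at h1 h2 h3
  constructor
  · linear_combination (norm := (ring_nf; simp only [Complex.I_sq, Complex.I_pow_three]; ring)) (2 * Complex.I) * h1 - 2 * T * h0
  · linear_combination (norm := (ring_nf; simp only [Complex.I_sq, Complex.I_pow_three]; ring)) (h2 + Complex.I * h3) - 2 * T * hm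

theorem bianchi₁₁ (h0 : w₀₀ 0 = 0) (hm : w₀₀ 2 + Complex.I * w₀₀ 3 = 0)
    (h : ∀ i j k, cyclicSum (fun i j k ↦ curv₁₁ (dW i) (dT i) (dV i) 0 j k
      - 2 * (curv₀₁ W T Λ j k * w₁₁ i - curv₁₁ W T V Λ j k * w₀₁ i)
      - bracket w₀₀ w₀₁ w₁₁ (curv₁₁ W T V Λ) i j k) i j k = 0) :
    dT 0 = dW 2 - Complex.I * dW 3 + 3 * W * w₁₁ 0 - 2 * w₀₁ 0 * T
        + 2 * (w₀₀ 2 - Complex.I * w₀₀ 3) * T ∧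
      dT 2 + Complex.I * dT 3 = dW 1 + 3 * W * (w₁₁ 2 + Complex.I * w₁₁ 3)
        - 2 * (w₀₁ 2 + Complex.I * w₀₁ 3) * T + 2 * w₀₀ 1 * T := by
  obtain ⟨r, s, rfl⟩ := exists_re_im w₀₀
  obtain ⟨r', s', rfl⟩ := exists_re_im w₀₁
  obtain ⟨r'', s'', rfl⟩ := exists_re_im w₁₁
  have h1 := h 0 2 3
  have h2 := h 0 1 2
  have h3 := h 0 1 3
  simp only at h0 hm ⊢
  simp [cyclicSum, curv₀₁, curv₁₁, bracket, SpinStructure.tetradVariation] at h1 h2 h3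
  constructor
  · linear_combination (norm := (ring_nf; simp only [Complex.I_sq, Complex.I_pow_three]; ring)) (2 * Complex.I) * h1 + 2 * V * h0
  · linear_combination (norm := (ring_nf; simp only [Complex.I_sq, Complex.I_pow_three]; ring)) (h2 + Complex.I * h3) + 2 * V * hm

end TypeII

section Spinors

variable {M : Type*} [TopologicalSpace M] [ChartedSpace E4 M] [IsManifold (𝓡 4) ∞ M]
  {S : M → Type*} [TopologicalSpace (TotalSpace SpinorModel S)]
  [∀ x, AddCommGroup (S x)] [∀ x, Module ℂ (S x)] [∀ x, TopologicalSpace (S x)]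
  [∀ x, IsTopologicalAddGroup (S x)] [∀ x, ContinuousSMul ℝ (S x)]
  [FiberBundle SpinorModel S] [VectorBundle ℝ SpinorModel S] [VectorBundle ℂ SpinorModel S]
  [ContMDiffVectorBundle ∞ SpinorModel S (𝓡 4)]

namespace SpinStructure

variable {g : LorentzMetric M} {sp : SpinStructure S g}

namespace IsSpinFrame

variable {D : CovariantDerivative (𝓡 4) E4 (TangentSpace (𝓡 4) : M → Type _)}
  {nabla : CovariantDerivative (𝓡 4) SpinorModel S} {U : Set M} {o ι : Π x : M, S x}
  (F : sp.IsSpinFrame D nabla U o ι)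
  {α β : Π x : M, S x} {X Y Z : Π x : M, TangentSpace (𝓡 4) x} {x : M}

include F

theorem curvature_zero_left (hα : SmoothSectionOn SpinorModel U α) (hx : x ∈ U)
    (Y : Π x : M, TangentSpace (𝓡 4) x) : nabla.curvature (fun _ ↦ 0) Y α x = 0 :=
  (CovariantDerivative.curvature_tensorialAt (F.spin.smooth U F.isOpen) F.isOpen hα hx).zero

theorem curvature_zero_right (hα : SmoothSectionOn SpinorModel U α) (hx : x ∈ U)
    (X : Π x : M, TangentSpace (𝓡 4) x) : nabla.curvature X (fun _ ↦ 0) α x = 0 := by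
  rw [CovariantDerivative.curvature_swap, F.curvature_zero_left hα hx, neg_zero]

theorem curvature_neg_right (hα : SmoothSectionOn SpinorModel U α) (hY : SmoothSectionOn E4 U Y)
    (hx : x ∈ U) (X : Π x : M, TangentSpace (𝓡 4) x) :
    nabla.curvature X (fun y ↦ -Y y) α x = -nabla.curvature X Y α x := by
  obtain ⟨L, hL⟩ := F.exists_curvature_hom (Y := X) (F.spin.smooth U F.isOpen) hα hx
  rw [CovariantDerivative.curvature_swap, CovariantDerivative.curvature_swap Y X, hL Y hY,
    hL (fun y ↦ -Y y) (fun y hy ↦ ContMDiffAt.neg_section (hY y hy)), _root_.map_neg]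

omit F in
theorem curvature_self (X : Π x : M, TangentSpace (𝓡 4) x) : nabla.curvature X X α x = 0 := by
  simp [CovariantDerivative.curvature]

omit F in
theorem imVec_self (sp : SpinStructure S g) (α : Π x : M, S x) : sp.imVec α α = fun _ ↦ 0 :=
  funext fun x ↦ sp.solder_self_I x (α x)

omit F in
theorem reVec_symm (sp : SpinStructure S g) (α β : Π x : M, S x) : sp.reVec β α = sp.reVec α β :=
  funext fun x ↦ sp.solder_symm x (β x) (α x)

omit F in
theorem imVec_symm (sp : SpinStructure S g) (α β : Π x : M, S x) :
    sp.imVec β α = fun x ↦ - sp.imVec α β x :=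
  funext fun x ↦ by rw [imVec, imVec, sp.solder_symm, sp.solder_I_left]

theorem curvatureSpinor_oo (hα : SmoothSectionOn SpinorModel U α) (hx : x ∈ U) :
    sp.curvatureSpinor nabla o ι o o α β x = sp.curv nabla (sp.tetrad o ι 0) (sp.tetrad o ι 2) α β x
      + Complex.I * sp.curv nabla (sp.tetrad o ι 0) (sp.tetrad o ι 3) α β x := by
  have e1 := CovariantDerivative.curvature_swap (cov := nabla) (sp.reVec o o) (sp.reVec o ι) α x
  have e2 := CovariantDerivative.curvature_swap (cov := nabla) (sp.reVec o o) (sp.imVec o ι) α x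
  simp only [curvatureSpinor, spinorCurvature, imVec_self, F.curvature_zero_left hα hx,
    F.curvature_zero_right hα hx, e1, e2, curv, tetrad, Matrix.cons_val, Matrix.cons_val_zero]
  simp only [_root_.map_sub, _root_.map_add, map_smul, _root_.map_neg, _root_.map_zero,
    LinearMap.sub_apply, LinearMap.add_apply, LinearMap.smul_apply, LinearMap.neg_apply,
    LinearMap.zero_apply, smul_eq_mul]
  ring

theorem curvatureSpinor_oι (hα : SmoothSectionOn SpinorModel U α) (hx : x ∈ U) :
    sp.curvatureSpinor nabla o ι o ι α β x
      = 1 / 2 * (sp.curv nabla (sp.tetrad o ι 0) (sp.tetrad o ι 1) α β x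
        + 2 * Complex.I * sp.curv nabla (sp.tetrad o ι 2) (sp.tetrad o ι 3) α β x) := by
  have e1 := CovariantDerivative.curvature_swap (cov := nabla) (sp.reVec o ι) (sp.imVec o ι) α x
  have hq : SmoothSectionOn E4 U (sp.imVec o ι) := F.smooth_tetrad 3
  simp only [curvatureSpinor, spinorCurvature, imVec_self, F.curvature_zero_left hα hx,
    F.curvature_zero_right hα hx, reVec_symm sp o ι, imVec_symm sp o ι,
    F.curvature_neg_right hα hq hx, curvature_self, e1, curv, tetrad, Matrix.cons_val,
    Matrix.cons_val_zero, Matrix.cons_val_one]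
  simp only [_root_.map_sub, _root_.map_add, map_smul, _root_.map_neg, _root_.map_zero,
    LinearMap.sub_apply, LinearMap.add_apply, LinearMap.smul_apply, LinearMap.neg_apply,
    LinearMap.zero_apply, smul_eq_mul]
  ring

section TypeII

variable {Λ : ℝ} (hE : g.IsEinstein D Λ) (hII : sp.IsTypeIIOn nabla U o ι)

include hE

theorem weyl_eq (hx : x ∈ U) :
    sp.Psi0 nabla o ι x = 2 * sp.curv nabla (sp.tetrad o ι 0) (sp.tetrad o ι 2) o o x ∧
    sp.Psi1 nabla o ι x = 2 * sp.curv nabla (sp.tetrad o ι 0) (sp.tetrad o ι 2) o ι x ∧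
    3 * sp.Psi2 nabla o ι x = 2 * sp.curv nabla (sp.tetrad o ι 0) (sp.tetrad o ι 2) ι ι x
      + 2 * sp.curv nabla (sp.tetrad o ι 0) (sp.tetrad o ι 1) o ι x ∧
    sp.Psi3 nabla o ι x = sp.curv nabla (sp.tetrad o ι 0) (sp.tetrad o ι 1) ι ι x := by
  have R := F.isEinsteinCurvature hE hx
  have ho := F.smooth_o
  have hι := F.smooth_ι
  have I2 := Complex.I_sq
  simp only [Psi0, Psi1, Psi2, Psi3, weylSpinor, F.curvatureSpinor_oo ho hx,
    F.curvatureSpinor_oo hι hx, F.curvatureSpinor_oι ho hx, F.curvatureSpinor_oι hι hx]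
  refine ⟨?_, ?_, ?_, ?_⟩
  · linear_combination Complex.I * R.lq₀₀
      - sp.curv nabla (sp.tetrad o ι 0) (sp.tetrad o ι 2) o o x * I2
  · linear_combination (2 / 3 * Complex.I) * R.lq₀₁ + (1 / 6 * Complex.I) * R.pq₀₀
      + (1 / 3) * R.symm₀₁
      - (2 / 3 * sp.curv nabla (sp.tetrad o ι 0) (sp.tetrad o ι 2) o ι x
        + 1 / 6 * sp.curv nabla (sp.tetrad o ι 0) (sp.tetrad o ι 1) o o x) * I2
  · linear_combination Complex.I * R.lq₁₁ + Complex.I * R.pq₀₁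
      - (sp.curv nabla (sp.tetrad o ι 0) (sp.tetrad o ι 2) ι ι x
        + sp.curv nabla (sp.tetrad o ι 0) (sp.tetrad o ι 1) o ι x) * I2
  · linear_combination (1 / 2 * Complex.I) * R.pq₁₁
      - (1 / 2 * sp.curv nabla (sp.tetrad o ι 0) (sp.tetrad o ι 1) ι ι x) * I2

omit F hE in
theorem eq_of_antisymm {A : Fin 4 → Fin 4 → ℂ} {B : Matrix (Fin 4) (Fin 4) ℂ}
    (hA : ∀ i j, A j i = -A i j) (hB : ∀ i j, B j i = -B i j) (h01 : A 0 1 = B 0 1)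
    (h02 : A 0 2 = B 0 2) (h03 : A 0 3 = B 0 3) (h12 : A 1 2 = B 1 2) (h13 : A 1 3 = B 1 3)
    (h23 : A 2 3 = B 2 3) (i j : Fin 4) : A i j = B i j := by
  have z : ∀ i, A i i = B i i := fun i ↦ by
    rw [self_eq_neg.1 (hA i i), self_eq_neg.1 (hB i i)]
  fin_cases i <;> fin_cases j <;>
    first
    | exact z _
    | assumption
    | (refine (hA _ _).trans (Eq.trans (congrArg Neg.neg ?_) (hB _ _).symm); assumption)

include hII

/-- The curvature of a type II Einstein spacetime in the tetrad. -/
theorem curv_eq_typeII (hx : x ∈ U) (i j : Fin 4) :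
    sp.curv nabla (sp.tetrad o ι i) (sp.tetrad o ι j) o o x
        = TypeII.curv₀₀ (sp.Psi2 nabla o ι x) Λ i j ∧
      sp.curv nabla (sp.tetrad o ι i) (sp.tetrad o ι j) o ι x
        = TypeII.curv₀₁ (sp.Psi2 nabla o ι x) (sp.Psi3 nabla o ι x) Λ i j ∧
      sp.curv nabla (sp.tetrad o ι i) (sp.tetrad o ι j) ι ι x
        = TypeII.curv₁₁ (sp.Psi2 nabla o ι x) (sp.Psi3 nabla o ι x)
          (sp.curv nabla (sp.tetrad o ι 1) (sp.tetrad o ι 2) ι ι x) Λ i j := by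
  obtain ⟨lq0, nq0, pq0, lq1, nq1, pq1, lq2, nq2, pq2, s01, s02, s12, tr⟩ :=
    F.isEinsteinCurvature hE hx
  obtain ⟨p0, p1, p2, p3⟩ := F.weyl_eq hE hx
  rw [hII.Psi0_eq x hx] at p0
  rw [hII.Psi1_eq x hx] at p1
  have e1 : sp.curv nabla (sp.tetrad o ι 0) (sp.tetrad o ι 1) o o x = 0 := by
    linear_combination s01 - p1
  have e2 : sp.curv nabla (sp.tetrad o ι 0) (sp.tetrad o ι 2) o o x = 0 := by
    linear_combination -p0 / 2
  have f1 : sp.curv nabla (sp.tetrad o ι 0) (sp.tetrad o ι 1) o ι x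
      = sp.Psi2 nabla o ι x - Λ := by
    linear_combination -tr / 3 - p2 / 3
  have f2 : sp.curv nabla (sp.tetrad o ι 0) (sp.tetrad o ι 2) o ι x = 0 := by
    linear_combination -p1 / 2
  have f3 : sp.curv nabla (sp.tetrad o ι 1) (sp.tetrad o ι 2) o ι x
      = -(sp.Psi3 nabla o ι x / 2) := by
    linear_combination s12 / 2 + p3 / 2
  have k2 : sp.curv nabla (sp.tetrad o ι 0) (sp.tetrad o ι 2) ι ι x
      = sp.Psi2 nabla o ι x / 2 + Λ := by
    linear_combination tr / 3 - p2 / 6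
  have e3 : sp.curv nabla (sp.tetrad o ι 1) (sp.tetrad o ι 2) o o x
      = -(sp.Psi2 nabla o ι x / 2 + Λ) := by
    linear_combination s02 - k2
  refine ⟨eq_of_antisymm (A := fun i j ↦ sp.curv nabla (sp.tetrad o ι i) (sp.tetrad o ι j) o o x)
      (fun _ _ ↦ curv_swap ..) ?_ ?_ ?_ ?_ ?_ ?_ ?_ i j,
    eq_of_antisymm (A := fun i j ↦ sp.curv nabla (sp.tetrad o ι i) (sp.tetrad o ι j) o ι x)
      (fun _ _ ↦ curv_swap ..) ?_ ?_ ?_ ?_ ?_ ?_ ?_ i j,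
    eq_of_antisymm (A := fun i j ↦ sp.curv nabla (sp.tetrad o ι i) (sp.tetrad o ι j) ι ι x)
      (fun _ _ ↦ curv_swap ..) ?_ ?_ ?_ ?_ ?_ ?_ ?_ i j⟩
  · intro i j
    fin_cases i <;> fin_cases j <;> simp [TypeII.curv₀₀]
  · simp only [TypeII.curv₀₀, Matrix.of_apply, Matrix.cons_val, Matrix.cons_val_zero,
      Matrix.cons_val_one]
    linear_combination e1
  · simp only [TypeII.curv₀₀, Matrix.of_apply, Matrix.cons_val, Matrix.cons_val_zero,
      Matrix.cons_val_one]
    linear_combination e2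
  · simp only [TypeII.curv₀₀, Matrix.of_apply, Matrix.cons_val, Matrix.cons_val_zero,
      Matrix.cons_val_one]
    linear_combination lq0 - Complex.I * e2
  · simp only [TypeII.curv₀₀, Matrix.of_apply, Matrix.cons_val, Matrix.cons_val_zero,
      Matrix.cons_val_one]
    linear_combination e3
  · simp only [TypeII.curv₀₀, Matrix.of_apply, Matrix.cons_val, Matrix.cons_val_zero,
      Matrix.cons_val_one]
    linear_combination nq0 + Complex.I * e3
  · simp only [TypeII.curv₀₀, Matrix.of_apply, Matrix.cons_val, Matrix.cons_val_zero,
      Matrix.cons_val_one]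
    linear_combination pq0 / 2 - Complex.I / 2 * e1
  · intro i j
    fin_cases i <;> fin_cases j <;> simp [TypeII.curv₀₁]
  · simp only [TypeII.curv₀₁, Matrix.of_apply, Matrix.cons_val, Matrix.cons_val_zero,
      Matrix.cons_val_one]
    linear_combination f1
  · simp only [TypeII.curv₀₁, Matrix.of_apply, Matrix.cons_val, Matrix.cons_val_zero,
      Matrix.cons_val_one]
    linear_combination f2
  · simp only [TypeII.curv₀₁, Matrix.of_apply, Matrix.cons_val, Matrix.cons_val_zero,
      Matrix.cons_val_one]
    linear_combination lq1 - Complex.I * f2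
  · simp only [TypeII.curv₀₁, Matrix.of_apply, Matrix.cons_val, Matrix.cons_val_zero,
      Matrix.cons_val_one]
    linear_combination f3
  · simp only [TypeII.curv₀₁, Matrix.of_apply, Matrix.cons_val, Matrix.cons_val_zero,
      Matrix.cons_val_one]
    linear_combination nq1 + Complex.I * f3
  · simp only [TypeII.curv₀₁, Matrix.of_apply, Matrix.cons_val, Matrix.cons_val_zero,
      Matrix.cons_val_one]
    linear_combination pq1 / 2 - Complex.I / 2 * f1
  · intro i j
    fin_cases i <;> fin_cases j <;> simp [TypeII.curv₁₁]
  · simp only [TypeII.curv₁₁, Matrix.of_apply, Matrix.cons_val, Matrix.cons_val_zero,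
      Matrix.cons_val_one]
    linear_combination -p3
  · simp only [TypeII.curv₁₁, Matrix.of_apply, Matrix.cons_val, Matrix.cons_val_zero,
      Matrix.cons_val_one]
    linear_combination k2
  · simp only [TypeII.curv₁₁, Matrix.of_apply, Matrix.cons_val, Matrix.cons_val_zero,
      Matrix.cons_val_one]
    linear_combination lq2 - Complex.I * k2
  · simp only [TypeII.curv₁₁, Matrix.of_apply, Matrix.cons_val, Matrix.cons_val_zero,
      Matrix.cons_val_one]
  · simp only [TypeII.curv₁₁, Matrix.of_apply, Matrix.cons_val, Matrix.cons_val_zero,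
      Matrix.cons_val_one]
    linear_combination nq2
  · simp only [TypeII.curv₁₁, Matrix.of_apply, Matrix.cons_val, Matrix.cons_val_zero,
      Matrix.cons_val_one]
    linear_combination pq2 / 2 + Complex.I / 2 * p3

end TypeII

end IsSpinFrame

end SpinStructure

end Spinors

section Calculus

variable {M : Type*} [TopologicalSpace M] [ChartedSpace E4 M]

theorem mvfderiv_affine {f a b c : M → ℂ} {x : M} {k ka kb kc : ℂ}
    (h : ∀ᶠ y in 𝓝 x, f y = k + a y * ka + b y * kb + c y * kc)
    (ha : MDifferentiableAt (𝓡 4) 𝓘(ℝ, ℂ) a x) (hb : MDifferentiableAt (𝓡 4) 𝓘(ℝ, ℂ) b x)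
    (hc : MDifferentiableAt (𝓡 4) 𝓘(ℝ, ℂ) c x) (v : TangentSpace (𝓡 4) x) :
    mvfderiv (𝓡 4) f x v = mvfderiv (𝓡 4) a x v * ka + mvfderiv (𝓡 4) b x v * kb
      + mvfderiv (𝓡 4) c x v * kc := by
  have hk : ∀ z : ℂ, MDifferentiableAt (𝓡 4) 𝓘(ℝ, ℂ) (fun _ : M ↦ z) x :=
    fun z ↦ mdifferentiableAt_const
  have hm : ∀ {p : M → ℂ} (z : ℂ), MDifferentiableAt (𝓡 4) 𝓘(ℝ, ℂ) p x →
      MDifferentiableAt (𝓡 4) 𝓘(ℝ, ℂ) (fun y ↦ p y * z) x :=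
    fun {p} z hp ↦ MDifferentiableAt.mul hp (hk z)
  rw [mvfderiv_congr h, show (fun y ↦ k + a y * ka + b y * kb + c y * kc)
      = (((fun _ : M ↦ k) + fun y ↦ a y * ka) + fun y ↦ b y * kb) + fun y ↦ c y * kc from rfl,
    mvfderiv_add (((hk k).add (hm ka ha)).add (hm kb hb)) (hm kc hc),
    mvfderiv_add ((hk k).add (hm ka ha)) (hm kb hb), mvfderiv_add (hk k) (hm ka ha)]
  simp only [_root_.add_apply, mvfderiv_complex_mul ha (hk ka), mvfderiv_complex_mul hb (hk kb),
    mvfderiv_complex_mul hc (hk kc), mvfderiv_const, _root_.zero_apply]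
  ring

end Calculus

namespace TypeII

theorem curv₀₀_affine (W Λ : ℂ) (i j : Fin 4) :
    curv₀₀ W Λ i j = curv₀₀ 0 Λ i j + W * curv₀₀ 1 0 i j := by
  fin_cases i <;> fin_cases j <;> simp [curv₀₀] <;> ring

theorem curv₀₁_affine (W T Λ : ℂ) (i j : Fin 4) :
    curv₀₁ W T Λ i j = curv₀₁ 0 0 Λ i j + W * curv₀₁ 1 0 0 i j + T * curv₀₁ 0 1 0 i j := by
  fin_cases i <;> fin_cases j <;> simp [curv₀₁] <;> ring

theorem curv₁₁_affine (W T V Λ : ℂ) (i j : Fin 4) :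
    curv₁₁ W T V Λ i j = curv₁₁ 0 0 0 Λ i j + W * curv₁₁ 1 0 0 0 i j + T * curv₁₁ 0 1 0 0 i j
      + V * curv₁₁ 0 0 1 0 i j := by
  fin_cases i <;> fin_cases j <;> simp [curv₁₁] <;> ring

end TypeII

section Spinors

variable {M : Type*} [TopologicalSpace M] [ChartedSpace E4 M] [IsManifold (𝓡 4) ∞ M]
  {S : M → Type*} [TopologicalSpace (TotalSpace SpinorModel S)]
  [∀ x, AddCommGroup (S x)] [∀ x, Module ℂ (S x)] [∀ x, TopologicalSpace (S x)]
  [∀ x, IsTopologicalAddGroup (S x)] [∀ x, ContinuousSMul ℝ (S x)]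
  [FiberBundle SpinorModel S] [VectorBundle ℝ SpinorModel S] [VectorBundle ℂ SpinorModel S]
  [ContMDiffVectorBundle ∞ SpinorModel S (𝓡 4)]

namespace SpinStructure

variable {g : LorentzMetric M} {sp : SpinStructure S g}

namespace IsSpinFrame

variable {D : CovariantDerivative (𝓡 4) E4 (TangentSpace (𝓡 4) : M → Type _)}
  {nabla : CovariantDerivative (𝓡 4) SpinorModel S} {U : Set M} {o ι : Π x : M, S x}
  (F : sp.IsSpinFrame D nabla U o ι)
  {α β : Π x : M, S x} {X Y Z : Π x : M, TangentSpace (𝓡 4) x} {x : M}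

include F

theorem eps_curvature_nabla (hx : x ∈ U) (v : TangentSpace (𝓡 4) x) :
    sp.eps x (nabla.curvature X Y α x) (nabla β x v)
      = sp.curv nabla X Y α o x * sp.conn nabla β ι x v
        - sp.curv nabla X Y α ι x * sp.conn nabla β o x v := by
  rw [sp.eps_dyad (F.dyad.normalized x hx), sp.eps_swap x (nabla β x v) (o x),
    sp.eps_swap x (nabla β x v) (ι x)]
  simp only [curv, conn]
  ring

theorem mdiff_curv (hα : SmoothSectionOn SpinorModel U α) (hβ : SmoothSectionOn SpinorModel U β)
    (hX : SmoothSectionOn E4 U X) (hY : SmoothSectionOn E4 U Y) (hx : x ∈ U) :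
    MDifferentiableAt (𝓡 4) 𝓘(ℝ, ℂ) (sp.curv nabla X Y α β) x :=
  F.mdiff_eps (F.smooth_curvature hX hY hα) hβ hx

variable {Λ : ℝ} (hE : g.IsEinstein D Λ) (hII : sp.IsTypeIIOn nabla U o ι)

include hE in
theorem mdiff_Psi3 (hx : x ∈ U) : MDifferentiableAt (𝓡 4) 𝓘(ℝ, ℂ) (sp.Psi3 nabla o ι) x := by
  refine (F.mdiff_curv F.smooth_ι F.smooth_ι (F.smooth_tetrad 0) (F.smooth_tetrad 1)
    hx).congr_of_eventuallyEq ?_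
  filter_upwards [F.isOpen.mem_nhds hx] with y hy
  exact (F.weyl_eq hE hy).2.2.2

include hE in
theorem mdiff_Psi2 (hx : x ∈ U) : MDifferentiableAt (𝓡 4) 𝓘(ℝ, ℂ) (sp.Psi2 nabla o ι) x := by
  have s := F.smooth_tetrad
  have h : MDifferentiableAt (𝓡 4) 𝓘(ℝ, ℂ) (fun y ↦ (2 / 3 : ℂ)
      * (sp.curv nabla (sp.tetrad o ι 0) (sp.tetrad o ι 2) ι ι y
        + sp.curv nabla (sp.tetrad o ι 0) (sp.tetrad o ι 1) o ι y)) x :=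
    MDifferentiableAt.mul mdifferentiableAt_const
      ((F.mdiff_curv F.smooth_ι F.smooth_ι (s 0) (s 2) hx).add
        (F.mdiff_curv F.smooth_o F.smooth_ι (s 0) (s 1) hx))
  refine h.congr_of_eventuallyEq ?_
  filter_upwards [F.isOpen.mem_nhds hx] with y hy
  linear_combination (F.weyl_eq hE hy).2.2.1 / 3

include hE hII

/-- The vacuum Bianchi identities `o^B ∇^A_{A'} Ψ_{ABCD} = 0` of a type II Einstein
spacetime. -/
theorem bianchi_typeII (hx : x ∈ U) :
    let w₀₀ := fun i ↦ sp.conn nabla o o x (sp.tetrad o ι i x)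
    let w₀₁ := fun i ↦ sp.conn nabla o ι x (sp.tetrad o ι i x)
    let w₁₁ := fun i ↦ sp.conn nabla ι ι x (sp.tetrad o ι i x)
    let W := sp.Psi2 nabla o ι x
    let T := sp.Psi3 nabla o ι x
    let dW := fun i ↦ mvfderiv (𝓡 4) (sp.Psi2 nabla o ι) x (sp.tetrad o ι i x)
    let dT := fun i ↦ mvfderiv (𝓡 4) (sp.Psi3 nabla o ι) x (sp.tetrad o ι i x)
    (w₀₀ 0 = 0 ∧ w₀₀ 2 + Complex.I * w₀₀ 3 = 0) ∧
    (dW 0 = 3 * W * (w₀₀ 2 - Complex.I * w₀₀ 3) ∧ dW 2 + Complex.I * dW 3 = 3 * W * w₀₀ 1) ∧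
    dT 0 = dW 2 - Complex.I * dW 3 + 3 * W * w₁₁ 0 - 2 * w₀₁ 0 * T
        + 2 * (w₀₀ 2 - Complex.I * w₀₀ 3) * T ∧
    dT 2 + Complex.I * dT 3 = dW 1 + 3 * W * (w₁₁ 2 + Complex.I * w₁₁ 3)
        - 2 * (w₀₁ 2 + Complex.I * w₀₁ 3) * T + 2 * w₀₀ 1 * T := by
  intro w₀₀ w₀₁ w₁₁ W T dW dT
  have s := F.smooth_tetrad
  have ho := F.smooth_o
  have hι := F.smooth_ι
  let v : M → ℂ := sp.curv nabla (sp.tetrad o ι 1) (sp.tetrad o ι 2) ι ι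
  let dV := fun i ↦ mvfderiv (𝓡 4) v x (sp.tetrad o ι i x)
  have hW := F.mdiff_Psi2 hE hx
  have hT := F.mdiff_Psi3 hE hx
  have hV : MDifferentiableAt (𝓡 4) 𝓘(ℝ, ℂ) v x := F.mdiff_curv hι hι (s 1) (s 2) hx
  have c00 : ∀ i j, sp.curv nabla (sp.tetrad o ι i) (sp.tetrad o ι j) o o x
      = TypeII.curv₀₀ W Λ i j := fun i j ↦ (F.curv_eq_typeII hE hII hx i j).1
  have c01 : ∀ i j, sp.curv nabla (sp.tetrad o ι i) (sp.tetrad o ι j) o ι x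
      = TypeII.curv₀₁ W T Λ i j := fun i j ↦ (F.curv_eq_typeII hE hII hx i j).2.1
  have c11 : ∀ i j, sp.curv nabla (sp.tetrad o ι i) (sp.tetrad o ι j) ι ι x
      = TypeII.curv₁₁ W T (v x) Λ i j := fun i j ↦ (F.curv_eq_typeII hE hII hx i j).2.2
  have c10 : ∀ i j, sp.curv nabla (sp.tetrad o ι i) (sp.tetrad o ι j) ι o x
      = TypeII.curv₀₁ W T Λ i j := fun i j ↦ by rw [F.curv_symm (s i) (s j) ho hι hx, c01]
  have w10 : ∀ i, sp.conn nabla ι o x (sp.tetrad o ι i x) = w₀₁ i := fun i ↦ F.conn_symm hx _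
  have d00 : ∀ i j k, mvfderiv (𝓡 4) (sp.curv nabla (sp.tetrad o ι j) (sp.tetrad o ι k) o o) x
      (sp.tetrad o ι i x) = TypeII.curv₀₀ (dW i) 0 j k := fun i j k ↦ by
    rw [mvfderiv_affine (k := TypeII.curv₀₀ 0 Λ j k) (ka := TypeII.curv₀₀ 1 0 j k)
      (kb := 0) (kc := 0) ?_ hW hT hV, TypeII.curv₀₀_affine (dW i) 0]
    · simp only [dW]
      simp [show TypeII.curv₀₀ 0 0 j k = 0 by fin_cases j <;> fin_cases k <;> simp [TypeII.curv₀₀]]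
    · filter_upwards [F.isOpen.mem_nhds hx] with y hy
      rw [(F.curv_eq_typeII hE hII hy j k).1, TypeII.curv₀₀_affine]
      ring
  have d01 : ∀ i j k, mvfderiv (𝓡 4) (sp.curv nabla (sp.tetrad o ι j) (sp.tetrad o ι k) o ι) x
      (sp.tetrad o ι i x) = TypeII.curv₀₁ (dW i) (dT i) 0 j k := fun i j k ↦ by
    rw [mvfderiv_affine (k := TypeII.curv₀₁ 0 0 Λ j k) (ka := TypeII.curv₀₁ 1 0 0 j k)
      (kb := TypeII.curv₀₁ 0 1 0 j k) (kc := 0) ?_ hW hT hV,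
      TypeII.curv₀₁_affine (dW i) (dT i) 0]
    · simp only [dW, dT]
      simp [show TypeII.curv₀₁ 0 0 0 j k = 0 by
        fin_cases j <;> fin_cases k <;> simp [TypeII.curv₀₁]]
    · filter_upwards [F.isOpen.mem_nhds hx] with y hy
      rw [(F.curv_eq_typeII hE hII hy j k).2.1, TypeII.curv₀₁_affine]
      ring
  have d11 : ∀ i j k, mvfderiv (𝓡 4) (sp.curv nabla (sp.tetrad o ι j) (sp.tetrad o ι k) ι ι) x
      (sp.tetrad o ι i x) = TypeII.curv₁₁ (dW i) (dT i) (dV i) 0 j k := fun i j k ↦ by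
    rw [mvfderiv_affine (k := TypeII.curv₁₁ 0 0 0 Λ j k) (ka := TypeII.curv₁₁ 1 0 0 0 j k)
      (kb := TypeII.curv₁₁ 0 1 0 0 j k) (kc := TypeII.curv₁₁ 0 0 1 0 j k) ?_ hW hT hV,
      TypeII.curv₁₁_affine (dW i) (dT i) (dV i) 0]
    · simp only [dW, dT, dV]
      simp [show TypeII.curv₁₁ 0 0 0 0 j k = 0 by
        fin_cases j <;> fin_cases k <;> simp [TypeII.curv₁₁]]
    · filter_upwards [F.isOpen.mem_nhds hx] with y hy
      rw [(F.curv_eq_typeII hE hII hy j k).2.2, TypeII.curv₁₁_affine]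
  have b : ∀ {α β : Π x : M, S x}, SmoothSectionOn SpinorModel U α → ∀ i j k,
      sp.curv nabla (mlieBracket (𝓡 4) (sp.tetrad o ι i) (sp.tetrad o ι j)) (sp.tetrad o ι k) α β x
        = TypeII.bracket w₀₀ w₀₁ w₁₁
          (fun m k ↦ sp.curv nabla (sp.tetrad o ι m) (sp.tetrad o ι k) α β x) i j k :=
    fun hα i j k ↦ F.curv_mlieBracket hα hx i j
  have B0 := TypeII.bianchi₀₀ (W := W) (T := T) (Λ := Λ) (w₀₀ := w₀₀) (w₀₁ := w₀₁) (w₁₁ := w₁₁)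
    (dW := dW) (hII.Psi2_ne x hx) fun i j k ↦ by
      have h := F.curv_bianchi ho ho (s i) (s j) (s k) hx
      simp only [F.eps_curvature_nabla hx, b ho, d00, c00, c01] at h
      simp only [TypeII.cyclicSum]
      linear_combination h
  have B1 := TypeII.bianchi₀₁ (W := W) (T := T) (V := v x) (Λ := Λ) (w₀₀ := w₀₀) (w₀₁ := w₀₁)
    (w₁₁ := w₁₁) (dW := dW) (dT := dT) B0.1 B0.2 fun i j k ↦ by
      have h := F.curv_bianchi ho hι (s i) (s j) (s k) hx
      simp only [F.eps_curvature_nabla hx, b ho, d01, c00, c01, c11, c10, w10] at h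
      simp only [TypeII.cyclicSum]
      linear_combination h
  have B2 := TypeII.bianchi₁₁ (W := W) (T := T) (V := v x) (Λ := Λ) (w₀₀ := w₀₀) (w₀₁ := w₀₁)
    (w₁₁ := w₁₁) (dW := dW) (dT := dT) (dV := dV) B0.1 B0.2 fun i j k ↦ by
      have h := F.curv_bianchi hι hι (s i) (s j) (s k) hx
      simp only [F.eps_curvature_nabla hx, b hι, d11, c11, c10, w10] at h
      simp only [TypeII.cyclicSum]
      linear_combination h
  exact ⟨B0, B1, B2⟩

end IsSpinFrame

end SpinStructure

end Spinors

section Calculus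

variable {M : Type*} [TopologicalSpace M] [ChartedSpace E4 M]

/-- A continuous branch of the cube root of a differentiable function is differentiable where it
does not vanish. -/
theorem mdifferentiableAt_cubeRoot {φ f : M → ℂ} {x : M} (hφ : ContinuousAt φ x)
    (h : ∀ᶠ y in 𝓝 x, φ y ^ 3 = f y) (hf : MDifferentiableAt (𝓡 4) 𝓘(ℝ, ℂ) f x)
    (h0 : φ x ≠ 0) : MDifferentiableAt (𝓡 4) 𝓘(ℝ, ℂ) φ x := by
  have hs : HasStrictDerivAt (fun z : ℂ ↦ z ^ 3) (3 * φ x ^ 2) (φ x) := by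
    simpa using hasStrictDerivAt_pow 3 (φ x)
  have hne : 3 * φ x ^ 2 ≠ 0 := by simpa using h0
  have hd : DifferentiableAt ℝ (hs.localInverse _ _ _ hne) (f x) := by
    rw [← h.self_of_nhds]
    exact (hs.to_localInverse hne).hasDerivAt.differentiableAt.restrictScalars ℝ
  refine (hd.mdifferentiableAt.comp x hf).congr_of_eventuallyEq ?_
  filter_upwards [h, hφ.eventually (hs.eventually_left_inverse hne)] with y hy hy'
  rw [Function.comp_apply, ← hy, hy']

theorem mdifferentiableAt_complex_inv {φ : M → ℂ} {x : M}
    (hφ : MDifferentiableAt (𝓡 4) 𝓘(ℝ, ℂ) φ x) (h0 : φ x ≠ 0) :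
    MDifferentiableAt (𝓡 4) 𝓘(ℝ, ℂ) (fun y ↦ (φ y)⁻¹) x :=
  ((differentiableAt_inv (𝕜 := ℂ) h0).restrictScalars ℝ).mdifferentiableAt.comp x hφ

/-- `d (f ^ (-1/3)) = -(1/3) f ^ (-4/3) df`. -/
theorem mvfderiv_inv_cubeRoot {φ f : M → ℂ} {x : M} (h : ∀ᶠ y in 𝓝 x, φ y ^ 3 = f y)
    (hφ : MDifferentiableAt (𝓡 4) 𝓘(ℝ, ℂ) φ x) (h0 : φ x ≠ 0) (v : TangentSpace (𝓡 4) x) :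
    mvfderiv (𝓡 4) (fun y ↦ (φ y)⁻¹) x v
      = -(1 / 3) * (φ x)⁻¹ ^ 4 * mvfderiv (𝓡 4) f x v := by
  have hφ2 : MDifferentiableAt (𝓡 4) 𝓘(ℝ, ℂ) (fun y ↦ φ y * φ y) x := MDifferentiableAt.mul hφ hφ
  have e : mvfderiv (𝓡 4) f x v = mvfderiv (𝓡 4) (fun y ↦ φ y * φ y * φ y) x v := by
    rw [mvfderiv_congr]
    filter_upwards [h] with y hy
    rw [← hy]
    ring
  have e' : mvfderiv (𝓡 4) (fun y ↦ (φ y)⁻¹ * φ y) x v = 0 := by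
    rw [mvfderiv_congr (g := fun _ ↦ 1), mvfderiv_const]
    · rfl
    · filter_upwards [hφ.continuousAt.eventually_ne h0] with y hy
      exact inv_mul_cancel₀ hy
  rw [mvfderiv_complex_mul hφ2 hφ, mvfderiv_complex_mul hφ hφ] at e
  rw [mvfderiv_complex_mul (mdifferentiableAt_complex_inv hφ h0) hφ] at e'
  rw [e]
  field_simp at e' ⊢
  linear_combination 3 * e'

end Calculus

/-- The spinor components of the projected Killing spinor equation, expressed along one spinor
index `A'`: the indices `0` and `1` refer to the derivatives along `o^A` and `ι^A`. -/
theorem TypeII.killing_components {u W T b₀ b₁ c₀ a₀ dW₀ dW₁ dT₀ : ℂ} (hu : W * u ^ 3 = 1)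
    (hb : b₀ = 0) (hW : dW₀ = 3 * W * b₁)
    (hT : dT₀ = dW₁ + 3 * W * c₀ - 2 * a₀ * T + 2 * b₁ * T) :
    u * b₀ = 0 ∧
    2 * (1 / 2 * (-(1 / 3) * u ^ 4 * dW₀) + 1 / 3 * u ^ 4 * T * b₀) + u * b₁ = 0 ∧
    (u * c₀ - 1 / 3 * (4 * u ^ 3 * (-(1 / 3) * u ^ 4 * dW₀) * T + u ^ 4 * dT₀)
        - 2 * a₀ * (1 / 3 * u ^ 4 * T))
      - 2 * (1 / 2 * (-(1 / 3) * u ^ 4 * dW₁) + 1 / 3 * u ^ 4 * T * b₁) = 0 := by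
  subst hb hW hT
  refine ⟨by ring, ?_, ?_⟩
  · linear_combination (- u * b₁) * hu
  · linear_combination (- u * c₀ + 4 / 3 * T * u ^ 4 * b₁) * hu

section Spinors

variable {M : Type*} [TopologicalSpace M] [ChartedSpace E4 M] [IsManifold (𝓡 4) ∞ M]
  {S : M → Type*} [TopologicalSpace (TotalSpace SpinorModel S)]
  [∀ x, AddCommGroup (S x)] [∀ x, Module ℂ (S x)] [∀ x, TopologicalSpace (S x)]
  [∀ x, IsTopologicalAddGroup (S x)] [∀ x, ContinuousSMul ℝ (S x)]
  [FiberBundle SpinorModel S] [VectorBundle ℝ SpinorModel S] [VectorBundle ℂ SpinorModel S]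
  [ContMDiffVectorBundle ∞ SpinorModel S (𝓡 4)]

namespace SpinStructure

variable {g : LorentzMetric M} {sp : SpinStructure S g}

/-- A real-linear form on tangent vectors, extended to the complex vector `α^A μ̄^{A'}`, in terms
of its values on the tetrad. -/
theorem complexify_apply {o ι α μ : Π x : M, S x} {x : M} (h : sp.eps x (o x) (ι x) = 1)
    {f : TangentSpace (𝓡 4) x → ℂ} (hf : IsLinearMap ℝ f) :
    f (sp.reVec α μ x) + Complex.I * f (sp.imVec α μ x)
      = sp.eps x (α x) (ι x) *
          ((starRingEnd ℂ) (sp.eps x (μ x) (ι x)) * f (sp.tetrad o ι 0 x)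
            + (starRingEnd ℂ) (sp.eps x (o x) (μ x))
              * (f (sp.tetrad o ι 2 x) + Complex.I * f (sp.tetrad o ι 3 x)))
        + sp.eps x (o x) (α x) *
          ((starRingEnd ℂ) (sp.eps x (μ x) (ι x))
              * (f (sp.tetrad o ι 2 x) - Complex.I * f (sp.tetrad o ι 3 x))
            + (starRingEnd ℂ) (sp.eps x (o x) (μ x)) * f (sp.tetrad o ι 1 x)) := by
  obtain ⟨L, rfl⟩ : ∃ L : TangentSpace (𝓡 4) x →ₗ[ℝ] ℂ, L = f := ⟨hf.mk' f, rfl⟩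
  have e1 : sp.solder x (ι x) (o x) = sp.solder x (o x) (ι x) := sp.solder_symm ..
  have e2 : sp.solder x (ι x) (Complex.I • o x) = - sp.solder x (o x) (Complex.I • ι x) := by
    rw [sp.solder_symm, sp.solder_I_left]
  simp only [reVec, imVec, tetrad]
  generalize hA : sp.eps x (α x) (ι x) = A
  generalize hA' : sp.eps x (o x) (α x) = A'
  generalize hm : sp.eps x (μ x) (ι x) = m
  generalize hm' : sp.eps x (o x) (μ x) = m'
  have hα : α x = A • o x + A' • ι x := by rw [← hA, ← hA']; exact sp.dyad_expand h _
  have hμ : μ x = m • o x + m' • ι x := by rw [← hm, ← hm']; exact sp.dyad_expand h _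
  let P : S x → S x → ℂ := fun σ τ ↦
    L (sp.solder x σ τ) + Complex.I * L (sp.solder x σ (Complex.I • τ))
  have II : ∀ τ : S x, Complex.I • Complex.I • τ = -τ := fun τ ↦ by
    rw [smul_smul, Complex.I_mul_I, neg_one_smul]
  have P_add_left : ∀ σ σ' τ, P (σ + σ') τ = P σ τ + P σ' τ := fun σ σ' τ ↦ by
    simp only [P, _root_.map_add, LinearMap.add_apply]
    ring
  have P_add_right : ∀ σ τ τ', P σ (τ + τ') = P σ τ + P σ τ' := fun σ τ τ' ↦ by
    simp only [P, _root_.map_add, smul_add]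
    ring
  have P_smul_left : ∀ (z : ℂ) σ τ, P (z • σ) τ = z * P σ τ := fun z σ τ ↦ by
    obtain ⟨a, b⟩ := z
    simp only [P, sp.solder_smul_left, II, map_sub, map_neg, map_smul, Complex.real_smul]
    rw [Complex.mk_eq_add_mul_I]
    linear_combination (b * L (sp.solder x σ (Complex.I • τ))) * -Complex.I_mul_I
  have P_smul_right : ∀ (z : ℂ) σ τ, P σ (z • τ) = (starRingEnd ℂ) z * P σ τ := fun z σ τ ↦ by
    rw [show P σ (z • τ) = L (sp.solder x σ (z • τ))
      + Complex.I * L (sp.solder x σ (z • Complex.I • τ)) by rw [smul_comm z]]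
    obtain ⟨a, b⟩ := z
    simp only [P, sp.solder_smul_right x ⟨a, b⟩, II, _root_.map_add, map_neg, map_smul,
      Complex.real_smul]
    simp only [Complex.mk_eq_add_mul_I, _root_.map_add, map_mul, Complex.conj_I,
      Complex.conj_ofReal]
    linear_combination (b * L (sp.solder x σ (Complex.I • τ))) * Complex.I_mul_I
  change P (α x) (μ x) = _
  rw [hα, hμ]
  simp only [P_add_left, P_add_right, P_smul_left, P_smul_right]
  simp only [P, e1, e2, sp.solder_self_I, map_zero, map_neg, reVec, imVec, Matrix.cons_val]
  ring

theorem isLinearMap_covDeriv₂ (nabla : CovariantDerivative (𝓡 4) SpinorModel S)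
    (K : Π x : M, S x →ₗ[ℂ] S x →ₗ[ℂ] ℂ) (β γ : Π x : M, S x) (x : M) :
    IsLinearMap ℝ (covDeriv₂ nabla K β γ x) := by
  constructor
  · intro v w
    simp only [covDeriv₂, _root_.map_add, LinearMap.add_apply]
    ring
  · intro r v
    have h : ∀ (r : ℝ) (σ : S x), r • σ = (r : ℂ) • σ := fun r σ ↦ rfl
    simp only [covDeriv₂, map_smul, h, LinearMap.smul_apply, Complex.real_smul, smul_eq_mul]
    ring

namespace IsSpinFrame

variable {D : CovariantDerivative (𝓡 4) E4 (TangentSpace (𝓡 4) : M → Type _)}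
  {nabla : CovariantDerivative (𝓡 4) SpinorModel S} {U : Set M} {o ι : Π x : M, S x}
  (F : sp.IsSpinFrame D nabla U o ι) {β γ : Π x : M, S x} {x : M}

include F

theorem covDeriv₂_dyad {p q : M → ℂ} (hp : MDifferentiableAt (𝓡 4) 𝓘(ℝ, ℂ) p x)
    (hq : MDifferentiableAt (𝓡 4) 𝓘(ℝ, ℂ) q x) (hβ : SmoothSpinorAt β x)
    (hγ : SmoothSpinorAt γ x) (hx : x ∈ U) (v : TangentSpace (𝓡 4) x) :
    covDeriv₂ nabla (fun y ↦ p y • ((1 / 2 : ℂ) • (sp.lowerMul o ι y + sp.lowerMul ι o y))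
        - q y • sp.lowerMul o o y) β γ x v
      = (p x * sp.conn nabla ι ι x v - mvfderiv (𝓡 4) q x v - 2 * sp.conn nabla o ι x v * q x)
          * (sp.eps x (o x) (β x) * sp.eps x (o x) (γ x))
        + (1 / 2 * mvfderiv (𝓡 4) p x v + q x * sp.conn nabla o o x v)
          * (sp.eps x (o x) (β x) * sp.eps x (ι x) (γ x)
            + sp.eps x (ι x) (β x) * sp.eps x (o x) (γ x))
        - p x * sp.conn nabla o o x v * (sp.eps x (ι x) (β x) * sp.eps x (ι x) (γ x)) := by
  have md : ∀ {α β : Π x : M, S x}, SmoothSpinorAt α x → SmoothSpinorAt β x →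
      MDifferentiableAt (𝓡 4) 𝓘(ℝ, ℂ) (fun y ↦ sp.eps y (α y) (β y)) x :=
    fun hα hβ ↦ (sp.eps_smooth x _ _ hα hβ).mdifferentiableAt (by simp)
  have mm : ∀ {a b : M → ℂ}, MDifferentiableAt (𝓡 4) 𝓘(ℝ, ℂ) a x →
      MDifferentiableAt (𝓡 4) 𝓘(ℝ, ℂ) b x →
      MDifferentiableAt (𝓡 4) 𝓘(ℝ, ℂ) (fun y ↦ a y * b y) x := fun ha hb ↦ MDifferentiableAt.mul ha hb
  have ho := F.dyad.smooth_fst x hx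
  have hι := F.dyad.smooth_snd x hx
  have h2 : MDifferentiableAt (𝓡 4) 𝓘(ℝ, ℂ) (fun _ : M ↦ (1 / 2 : ℂ)) x := mdifferentiableAt_const
  have e : (fun y ↦ (p y • ((1 / 2 : ℂ) • (sp.lowerMul o ι y + sp.lowerMul ι o y))
        - q y • sp.lowerMul o o y) (β y) (γ y))
      = ((fun y ↦ (1 / 2 * p y) * (sp.eps y (o y) (β y) * sp.eps y (ι y) (γ y)))
        + fun y ↦ (1 / 2 * p y) * (sp.eps y (ι y) (β y) * sp.eps y (o y) (γ y)))
        - fun y ↦ q y * (sp.eps y (o y) (β y) * sp.eps y (o y) (γ y)) := by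
    funext y
    simp [lowerMul, lower]
    ring
  have m1 := mm (mm h2 hp) (mm (md ho hβ) (md hι hγ))
  have m2 := mm (mm h2 hp) (mm (md hι hβ) (md ho hγ))
  have m3 := mm hq (mm (md ho hβ) (md ho hγ))
  rw [covDeriv₂, e, mvfderiv_sub (m1.add m2) m3, mvfderiv_add m1 m2]
  simp only [_root_.add_apply, _root_.sub_apply]
  rw [mvfderiv_complex_mul (mm h2 hp) (mm (md ho hβ) (md hι hγ)),
    mvfderiv_complex_mul (mm h2 hp) (mm (md hι hβ) (md ho hγ)),
    mvfderiv_complex_mul hq (mm (md ho hβ) (md ho hγ)), mvfderiv_complex_mul h2 hp,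
    mvfderiv_complex_mul (md ho hβ) (md hι hγ), mvfderiv_complex_mul (md hι hβ) (md ho hγ),
    mvfderiv_complex_mul (md ho hβ) (md ho hγ), mvfderiv_const,
    F.spin.eps_parallel x o β ho hβ, F.spin.eps_parallel x o γ ho hγ,
    F.spin.eps_parallel x ι β hι hβ, F.spin.eps_parallel x ι γ hι hγ, F.nabla_o hx, F.nabla_ι hx]
  simp [lowerMul, lower]
  ring

variable {Λ : ℝ} (hE : g.IsEinstein D Λ) (hII : sp.IsTypeIIOn nabla U o ι)
  {φ : M → ℂ} (hφ : ContinuousOn φ U) (hφ3 : ∀ x ∈ U, φ x ^ 3 = sp.Psi2 nabla o ι x)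

include hE hII hφ hφ3

theorem covDeriv₂_killingField (hβ : SmoothSpinorAt β x)
    (hγ : SmoothSpinorAt γ x) (hx : x ∈ U) (v : TangentSpace (𝓡 4) x) :
    covDeriv₂ nabla (sp.killingField nabla o ι φ) β γ x v
      = ((φ x)⁻¹ * sp.conn nabla ι ι x v
          - 1 / 3 * (4 * (φ x)⁻¹ ^ 3
              * (-(1 / 3) * (φ x)⁻¹ ^ 4 * mvfderiv (𝓡 4) (sp.Psi2 nabla o ι) x v)
              * sp.Psi3 nabla o ι x
            + (φ x)⁻¹ ^ 4 * mvfderiv (𝓡 4) (sp.Psi3 nabla o ι) x v)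
          - 2 * sp.conn nabla o ι x v * (1 / 3 * (φ x)⁻¹ ^ 4 * sp.Psi3 nabla o ι x))
          * (sp.eps x (o x) (β x) * sp.eps x (o x) (γ x))
        + (1 / 2 * (-(1 / 3) * (φ x)⁻¹ ^ 4 * mvfderiv (𝓡 4) (sp.Psi2 nabla o ι) x v)
            + 1 / 3 * (φ x)⁻¹ ^ 4 * sp.Psi3 nabla o ι x * sp.conn nabla o o x v)
          * (sp.eps x (o x) (β x) * sp.eps x (ι x) (γ x)
            + sp.eps x (ι x) (β x) * sp.eps x (o x) (γ x))
        - (φ x)⁻¹ * sp.conn nabla o o x v * (sp.eps x (ι x) (β x) * sp.eps x (ι x) (γ x)) := by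
  have h0 : φ x ≠ 0 := fun h ↦ hII.Psi2_ne x hx (by rw [← hφ3 x hx, h]; ring)
  have hev : ∀ᶠ y in 𝓝 x, φ y ^ 3 = sp.Psi2 nabla o ι y := by
    filter_upwards [F.isOpen.mem_nhds hx] with y hy using hφ3 y hy
  have hd := mdifferentiableAt_cubeRoot (hφ.continuousAt (F.isOpen.mem_nhds hx)) hev
    (F.mdiff_Psi2 hE hx) h0
  have hu := mdifferentiableAt_complex_inv hd h0
  have hT := F.mdiff_Psi3 hE hx
  have hu2 : MDifferentiableAt (𝓡 4) 𝓘(ℝ, ℂ) (fun y ↦ (φ y)⁻¹ * (φ y)⁻¹) x :=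
    MDifferentiableAt.mul hu hu
  have hu4 : MDifferentiableAt (𝓡 4) 𝓘(ℝ, ℂ)
      (fun y ↦ (φ y)⁻¹ * (φ y)⁻¹ * ((φ y)⁻¹ * (φ y)⁻¹)) x := MDifferentiableAt.mul hu2 hu2
  have h3 : MDifferentiableAt (𝓡 4) 𝓘(ℝ, ℂ) (fun _ : M ↦ (1 / 3 : ℂ)) x := mdifferentiableAt_const
  have hu4' : MDifferentiableAt (𝓡 4) 𝓘(ℝ, ℂ)
      (fun y ↦ 1 / 3 * ((φ y)⁻¹ * (φ y)⁻¹ * ((φ y)⁻¹ * (φ y)⁻¹))) x := MDifferentiableAt.mul h3 hu4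
  have hq : MDifferentiableAt (𝓡 4) 𝓘(ℝ, ℂ) (fun y ↦ 1 / 3
      * ((φ y)⁻¹ * (φ y)⁻¹ * ((φ y)⁻¹ * (φ y)⁻¹)) * sp.Psi3 nabla o ι y) x :=
    MDifferentiableAt.mul hu4' hT
  have e : sp.killingField nabla o ι φ
      = fun y ↦ (φ y)⁻¹ • ((1 / 2 : ℂ) • (sp.lowerMul o ι y + sp.lowerMul ι o y))
        - (1 / 3 * ((φ y)⁻¹ * (φ y)⁻¹ * ((φ y)⁻¹ * (φ y)⁻¹)) * sp.Psi3 nabla o ι y)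
          • sp.lowerMul o o y := by
    funext y
    rw [killingField, show (φ y ^ 4)⁻¹ = (φ y)⁻¹ * (φ y)⁻¹ * ((φ y)⁻¹ * (φ y)⁻¹) by
      rw [← inv_pow]; ring]
  rw [e, F.covDeriv₂_dyad hu hq hβ hγ hx, mvfderiv_complex_mul hu4' hT,
    mvfderiv_complex_mul h3 hu4, mvfderiv_complex_mul hu2 hu2, mvfderiv_complex_mul hu hu,
    mvfderiv_const, mvfderiv_inv_cubeRoot hev hd h0]
  simp only [_root_.zero_apply]
  ring

theorem isProjectedKillingSpinorOn_killingField :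
    sp.IsProjectedKillingSpinorOn nabla U o (sp.killingField nabla o ι φ) := by
  intro x hx β γ μ hβ hγ _
  have ho := F.dyad.smooth_fst x hx
  have hn := F.dyad.normalized x hx
  have hs : sp.eps x (ι x) (o x) = -1 := by rw [sp.eps_swap, hn]
  have h0 : φ x ≠ 0 := fun h ↦ hII.Psi2_ne x hx (by rw [← hφ3 x hx, h]; ring)
  have hu : sp.Psi2 nabla o ι x * (φ x)⁻¹ ^ 3 = 1 := by
    rw [← hφ3 x hx]
    field_simp
  obtain ⟨⟨k0, k2⟩, ⟨w0, w2⟩, t0, t2⟩ := F.bianchi_typeII hE hII hx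
  obtain ⟨p1, p2, p3⟩ := TypeII.killing_components hu k0 w0 t0
  obtain ⟨q1, q2, q3⟩ := TypeII.killing_components hu k2 w2 t2
  have c := fun {β γ : Π x : M, S x} (hβ : SmoothSpinorAt β x) (hγ : SmoothSpinorAt γ x) ↦
    F.covDeriv₂_killingField hE hII hφ hφ3 hβ hγ hx
  simp only [symDeriv₂, spinorDeriv₂,
    complexify_apply hn (isLinearMap_covDeriv₂ nabla (sp.killingField nabla o ι φ) _ _ x)]
  simp only [c ho hβ, c ho hγ, c hβ ho, c hγ ho, c hβ hγ, c hγ hβ, hs, hn, sp.eps_self,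
    sp.eps_swap x (ι x) (β x), sp.eps_swap x (ι x) (γ x)]
  generalize (starRingEnd ℂ) (sp.eps x (μ x) (ι x)) = m
  generalize (starRingEnd ℂ) (sp.eps x (o x) (μ x)) = m'
  generalize sp.eps x (ι x) (β x) = B1
  generalize sp.eps x (o x) (β x) = B0
  generalize sp.eps x (ι x) (γ x) = G1
  generalize sp.eps x (o x) (γ x) = G0
  dsimp only at p1 p2 p3 q1 q2 q3
  linear_combination
    1 / 3 * m * (B0 * G0 * p3 + (B0 * G1 + B1 * G0) * p2 - 3 * B1 * G1 * p1)
      + 1 / 3 * m' * (B0 * G0 * q3 + (B0 * G1 + B1 * G0) * q2 - 3 * B1 * G1 * q1)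

end IsSpinFrame

end SpinStructure

end Spinors

end

theorem typeII_projected_killing_spinor
    {M : Type*} [TopologicalSpace M] [ChartedSpace E4 M] [IsManifold (𝓡 4) ∞ M]
    {S : M → Type*} [TopologicalSpace (TotalSpace SpinorModel S)]
    [∀ x, AddCommGroup (S x)] [∀ x, Module ℂ (S x)] [∀ x, TopologicalSpace (S x)]
    [∀ x, IsTopologicalAddGroup (S x)] [∀ x, ContinuousSMul ℝ (S x)]
    [FiberBundle SpinorModel S] [VectorBundle ℝ SpinorModel S] [VectorBundle ℂ SpinorModel S]
    [ContMDiffVectorBundle ∞ SpinorModel S (𝓡 4)]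
    (g : LorentzMetric M) (sp : SpinStructure S g)
    (D : CovariantDerivative (𝓡 4) E4 (TangentSpace (𝓡 4) : M → Type _))
    (hD : g.IsLeviCivita D)
    (nabla : CovariantDerivative (𝓡 4) SpinorModel S)
    (hnabla : sp.IsSpinConnection D nabla)
    (Λ : ℝ) (hE : g.IsEinstein D Λ)
    (U : Set M) (hU : IsOpen U) (o ι : Π x : M, S x)
    (hdyad : sp.IsDyadOn U o ι)
    (hII : sp.IsTypeIIOn nabla U o ι)
    (φ : M → ℂ) (hφ : ContinuousOn φ U)
    (hφ3 : ∀ x ∈ U, φ x ^ 3 = sp.Psi2 nabla o ι x) :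
    sp.IsProjectedKillingSpinorOn nabla U o (sp.killingField nabla o ι φ) := by
  have F : sp.IsSpinFrame D nabla U o ι := ⟨hD, hnabla, hU, hdyad⟩
  exact F.isProjectedKillingSpinorOn_killingField hE hII hφ hφ3
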